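/- arXiv:1006.1759 — 2 statements merged into one kernel-verified Lean document; each statement's English description precedes it below -/
import Mathlib

section
/- Let n ≥ 2 and r, s ≥ 1 be integers with gcd(n−1, r) = gcd(n−1, s). Then the Higman–Thompson groups G_{n,r} and G_{n,s} are isomorphic as groups. -/
/-- A point `x_i α` of `X_r W_n`: the letter `x_i` together with a word `α` over `{1,…,n}`. -/
abbrev HTPt (n r : ℕ) := Fin r × List (Fin n)

/-- The right action of the free monoid `W_n` on `X_r W_n`: `(x_i α) · w = x_i (α w)`. -/
def HTact {n r : ℕ} (u : HTPt n r) (w : List (Fin n)) : HTPt n r := (u.1, u.2 ++ w)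

/-- A subspace of `X_r W_n`: a nonempty subset closed under the right `W_n`-action. -/
def IsSubspace {n r : ℕ} (V : Set (HTPt n r)) : Prop :=
  V.Nonempty ∧ ∀ u ∈ V, ∀ w : List (Fin n), HTact u w ∈ V

/-- A cofinite subset of `X_r W_n`. -/
def IsCofinite {n r : ℕ} (V : Set (HTPt n r)) : Prop := Set.Finite Vᶜ

/-- A cofinite isomorphism of `X_r W_n`: a bijective homomorphism (partial map commuting with
the right `W_n`-action) between cofinite subspaces. -/
def IsCofIso {n r : ℕ} (θ : HTPt n r →. HTPt n r) : Prop :=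
  IsSubspace θ.Dom ∧ IsCofinite θ.Dom ∧ IsSubspace θ.ran ∧ IsCofinite θ.ran ∧
    (∀ u v, v ∈ θ u → ∀ w : List (Fin n), HTact v w ∈ θ (HTact u w)) ∧
    (∀ u₁ u₂ v, v ∈ θ u₁ → v ∈ θ u₂ → u₁ = u₂)

/-- `θ'` extends `θ`: `θ' u = θ u` whenever `θ u` is defined. -/
def HTExtends {n r : ℕ} (θ' θ : HTPt n r →. HTPt n r) : Prop :=
  ∀ u v, v ∈ θ u → v ∈ θ' u

/-- A maximal cofinite isomorphism: its only extension is itself. -/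
def IsMaxCofIso {n r : ℕ} (θ : HTPt n r →. HTPt n r) : Prop :=
  IsCofIso θ ∧ ∀ θ', IsCofIso θ' → HTExtends θ' θ → θ' = θ

/-- The underlying set of the Higman–Thompson group `G_{n,r}`: the maximal cofinite
isomorphisms of `X_r W_n`. -/
abbrev HT (n r : ℕ) := {θ : HTPt n r →. HTPt n r // IsMaxCofIso θ}

/-- `mul` is the Higman–Thompson multiplication: `mul φ₁ φ₂` is the (unique) maximal
extension of the composite `u ↦ φ₂ (φ₁ u)`. -/
def IsHTMul (n r : ℕ) (mul : HT n r → HT n r → HT n r) : Prop :=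
  ∀ φ₁ φ₂ : HT n r, HTExtends (mul φ₁ φ₂).val (PFun.comp φ₂.val φ₁.val)
namespace HigmanThompson

open Filter Topology Function

/-- Concatenation of a finite word and an infinite word. -/
def cat {α : Type*} (u : List α) (w : ℕ → α) : ℕ → α :=
  fun k => if h : k < u.length then u[k] else w (k - u.length)

/-- Removal of the first `m` letters of an infinite word. -/
def drop {α : Type*} (m : ℕ) (w : ℕ → α) : ℕ → α := fun k => w (k + m)

/-- The first `m` letters of an infinite word. -/
def pre {α : Type*} (m : ℕ) (w : ℕ → α) : List α := List.ofFn fun i : Fin m => w i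

section Words

variable {α : Type*}

@[simp] lemma cat_nil (w : ℕ → α) : cat [] w = w := by
  funext k; simp [cat]

lemma cat_append (u v : List α) (w : ℕ → α) : cat (u ++ v) w = cat u (cat v w) := by
  funext k
  simp only [cat, List.length_append, List.getElem_append]
  split_ifs <;> first | rfl | omega | (congr 1; omega)

@[simp] lemma drop_zero (w : ℕ → α) : drop 0 w = w := rfl

lemma drop_drop (m k : ℕ) (w : ℕ → α) : drop m (drop k w) = drop (m + k) w := by
  funext i; simp [drop, Nat.add_assoc]

lemma drop_add_congr {w z : ℕ → α} {m k : ℕ} (h : drop m w = drop k z) (l : ℕ) :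
    drop (l + m) w = drop (l + k) z := by
  rw [← drop_drop, h, drop_drop]

@[simp] lemma drop_cat (u : List α) (w : ℕ → α) : drop u.length (cat u w) = w := by
  funext k; simp [drop, cat]

lemma drop_cat_of_length {m : ℕ} {u : List α} (h : u.length = m) (w : ℕ → α) :
    drop m (cat u w) = w :=
  h ▸ drop_cat u w

@[simp] lemma length_pre (m : ℕ) (w : ℕ → α) : (pre m w).length = m := by simp [pre]

@[simp] lemma cat_pre_drop (m : ℕ) (w : ℕ → α) : cat (pre m w) (drop m w) = w := by
  funext k
  simp only [cat, drop, pre, List.length_ofFn, List.getElem_ofFn]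
  split_ifs with h
  · rfl
  · congr 1; omega

lemma pre_cat (u : List α) (w : ℕ → α) : pre u.length (cat u w) = u := by
  apply List.ext_getElem <;> simp +contextual [pre, cat]

lemma pre_cat_of_length {m : ℕ} {u : List α} (h : u.length = m) (w : ℕ → α) :
    pre m (cat u w) = u :=
  h ▸ pre_cat u w

lemma pre_congr {m : ℕ} {w z : ℕ → α} (h : ∀ i < m, w i = z i) : pre m w = pre m z := by
  simp only [pre]; congr 1; funext i; exact h i i.2

lemma pre_add (m k : ℕ) (w : ℕ → α) : pre (m + k) w = pre m w ++ pre k (drop m w) := by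
  apply List.ext_getElem
  · simp
  · intro i h1 h2
    simp only [pre, drop, List.getElem_ofFn, List.getElem_append, List.length_ofFn]
    split_ifs
    · rfl
    · congr 1; omega

lemma cat_injective (u : List α) : Injective (cat u) := fun w z h => by
  rw [← drop_cat u w, h, drop_cat]

lemma cat_apply_of_lt {u : List α} (w z : ℕ → α) {k : ℕ} (h : k < u.length) :
    cat u w k = cat u z k := by
  simp [cat, h]

lemma cat_eq_cat {u v : List α} {w z : ℕ → α} (h : cat u w = cat v z)
    (hl : u.length ≤ v.length) : ∃ t, v = u ++ t ∧ w = cat t z := by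
  have hv : v = u ++ pre (v.length - u.length) w := by
    conv_lhs => rw [← pre_cat v z, ← h, ← Nat.add_sub_cancel' hl, pre_add, pre_cat, drop_cat]
  refine ⟨_, hv, cat_injective u ?_⟩
  rw [← cat_append, ← hv, h]

lemma eq_nil_of_forall_cat [Nontrivial α] {t : List α} (h : ∀ w : ℕ → α, cat t w = w) :
    t = [] := by
  obtain ⟨a, b, hab⟩ := exists_pair_ne α
  by_contra ht
  have hl : 0 < t.length := List.length_pos_iff.2 ht
  have h1 := congrFun (h fun _ => a) 0
  have h2 := congrFun (h fun _ => b) 0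
  rw [cat_apply_of_lt _ (fun _ => b) hl, h2] at h1
  exact hab h1.symm

lemma eq_of_forall_cat [Nontrivial α] {u v : List α} (h : ∀ w : ℕ → α, cat u w = cat v w) :
    u = v := by
  wlog hl : u.length ≤ v.length generalizing u v
  · exact (this (fun w => (h w).symm) (by omega)).symm
  obtain ⟨t, rfl, -⟩ := cat_eq_cat (h fun _ => Classical.arbitrary α) hl
  have : t = [] := eq_nil_of_forall_cat fun w => cat_injective u (by rw [← cat_append, ← h])
  simp [this]

variable [TopologicalSpace α]

lemma continuous_drop (m : ℕ) : Continuous (drop m : (ℕ → α) → ℕ → α) :=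
  continuous_pi fun k => continuous_apply (k + m)

lemma continuous_cat (u : List α) : Continuous (cat u) := by
  refine continuous_pi fun k => ?_
  by_cases h : k < u.length
  · simpa [cat, h] using continuous_const
  · simpa [cat, h] using continuous_apply _

end Words

/-- The end space of a forest with roots `ι` and branching letters `α`. -/
abbrev Ends (α ι : Type*) := ι × (ℕ → α)

section Ends

variable {α ι κ : Type*} [TopologicalSpace α] [DiscreteTopology α]
  [TopologicalSpace ι] [DiscreteTopology ι] [TopologicalSpace κ] [DiscreteTopology κ]

lemma eventually_cylinder (x : Ends α ι) (m : ℕ) :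
    ∀ᶠ y in 𝓝 x, y.1 = x.1 ∧ ∀ i < m, y.2 i = x.2 i := by
  have h1 : ∀ᶠ y in 𝓝 x, y.1 = x.1 :=
    ((isOpen_discrete {x.1}).preimage continuous_fst).mem_nhds rfl
  have h2 : ∀ i < m, ∀ᶠ y in 𝓝 x, y.2 i = x.2 i := fun i _ =>
    ((isOpen_discrete {x.2 i}).preimage
      (f := fun y : Ends α ι => y.2 i) (by fun_prop)).mem_nhds rfl
  have h3 := (Filter.eventually_all_finite (Set.finite_Iio m)).2 h2
  filter_upwards [h1, h3] with y a b using ⟨a, b⟩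

lemma eventually_pre (x : Ends α ι) (m : ℕ) :
    ∀ᶠ y in 𝓝 x, y.1 = x.1 ∧ pre m y.2 = pre m x.2 := by
  filter_upwards [eventually_cylinder x m] with y hy using ⟨hy.1, pre_congr hy.2⟩

lemma exists_cylinder {x : Ends α ι} {P : Ends α ι → Prop} (h : ∀ᶠ y in 𝓝 x, P y) :
    ∃ m, ∀ y : Ends α ι, y.1 = x.1 → pre m y.2 = pre m x.2 → P y := by
  rw [nhds_prod_eq, nhds_discrete, Filter.eventually_prod_iff] at h
  obtain ⟨pa, ha, pb, hb, hP⟩ := h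
  obtain ⟨v, ⟨z, m, rfl⟩, hx, hv⟩ :=
    (PiNat.isTopologicalBasis_cylinders fun _ : ℕ => α).mem_nhds_iff.1 hb
  refine ⟨m, fun y h1 h2 => hP (x := y.1) (by rw [h1]; simpa using ha) (hv ?_)⟩
  intro i hi
  have := congrArg (fun l => l[i]?) h2
  simp [pre, hi] at this
  rw [this]; exact hx i hi

end Ends

section TailEquivalence

variable {α ι κ : Type*} [TopologicalSpace α] [TopologicalSpace ι]

/-- `h` maps pairs of points with locally matching tails to such pairs. -/
def TailCompat (h : Ends α ι → Ends α κ) : Prop :=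
  ∀ (x x' : Ends α ι) (m k : ℕ), drop m x.2 = drop k x'.2 →
    ∃ M K, ∀ᶠ p in 𝓝 (x, x'), drop m p.1.2 = drop k p.2.2 → drop M (h p.1).2 = drop K (h p.2).2

/-- `h` is locally a replacement of prefixes. -/
def LocallyPrefix (h : Ends α ι → Ends α κ) : Prop :=
  ∀ x, ∃ m k, ∀ᶠ y in 𝓝 x, drop m y.2 = drop k (h y).2

lemma LocallyPrefix.tailCompat {h : Ends α ι → Ends α κ} (H : LocallyPrefix h) :
    TailCompat h := by
  intro x x' m k _
  obtain ⟨a, b, hab⟩ := H x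
  obtain ⟨a', b', hab'⟩ := H x'
  refine ⟨a' + m + b, a + k + b', ?_⟩
  filter_upwards [hab.prod_nhds hab'] with p ⟨h1, h2⟩ h3
  have e1 := drop_add_congr h1 (a' + m)
  have e2 := drop_add_congr h2 (a + k)
  have e3 := drop_add_congr h3 (a + a')
  rw [← e1, ← e2]
  convert e3 using 2 <;> omega

/-- A homeomorphism of end spaces compatible with tails in both directions exists. -/
def TailEquivalent (α ι κ : Type*) [TopologicalSpace α] [TopologicalSpace ι]
    [TopologicalSpace κ] : Prop :=
  ∃ h : Ends α ι ≃ₜ Ends α κ, TailCompat h ∧ TailCompat h.symm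

lemma TailCompat.prod (η : Type*) [TopologicalSpace η] {h : Ends α ι → Ends α κ}
    (H : TailCompat h) :
    TailCompat fun x : Ends α (η × ι) => ((x.1.1, (h (x.1.2, x.2)).1), (h (x.1.2, x.2)).2) := by
  intro x x' m k e
  obtain ⟨M, K, HM⟩ := H (x.1.2, x.2) (x'.1.2, x'.2) m k e
  refine ⟨M, K, ?_⟩
  have c : Continuous fun p : Ends α (η × ι) × Ends α (η × ι) =>
      (((p.1.1.2, p.1.2) : Ends α ι), ((p.2.1.2, p.2.2) : Ends α ι)) := by fun_prop
  exact (c.tendsto (x, x')).eventually HM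

variable [TopologicalSpace κ]

lemma TailEquivalent.symm (h : TailEquivalent α ι κ) : TailEquivalent α κ ι :=
  let ⟨h, h1, h2⟩ := h
  ⟨h.symm, h2, h1⟩

lemma TailCompat.comp {η : Type*} [TopologicalSpace η] {g : Ends α κ → Ends α η}
    {h : Ends α ι → Ends α κ} (hg : TailCompat g) (hh : TailCompat h) (hc : Continuous h) :
    TailCompat (g ∘ h) := by
  intro x x' m k e
  obtain ⟨M, K, H⟩ := hh x x' m k e
  obtain ⟨M', K', H'⟩ := hg (h x) (h x') M K (H.self_of_nhds e)
  refine ⟨M', K', ?_⟩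
  have := (hc.prodMap hc).continuousAt (x := (x, x')) |>.eventually H'
  filter_upwards [H, this] with p h1 h2 h3 using h2 (h1 h3)

lemma TailEquivalent.trans {η : Type*} [TopologicalSpace η] (h : TailEquivalent α ι κ)
    (g : TailEquivalent α κ η) : TailEquivalent α ι η :=
  let ⟨h, h1, h2⟩ := h
  let ⟨g, g1, g2⟩ := g
  ⟨h.trans g, g1.comp h1 h.continuous, h2.comp g2 g.symm.continuous⟩

lemma LocallyPrefix.symm {h : Ends α ι ≃ₜ Ends α κ} (H : LocallyPrefix h) :
    LocallyPrefix h.symm := by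
  intro x
  obtain ⟨m, k, hm⟩ := H (h.symm x)
  refine ⟨k, m, ?_⟩
  filter_upwards [h.symm.continuous.continuousAt.eventually hm] with y hy
  simpa using hy.symm

lemma LocallyPrefix.tailEquivalent {h : Ends α ι ≃ₜ Ends α κ} (H : LocallyPrefix h) :
    TailEquivalent α ι κ :=
  ⟨h, H.tailCompat, H.symm.tailCompat⟩

/-- Homeomorphisms of the end space that are locally prefix replacements. -/
def prefixGroup (α ι : Type*) [TopologicalSpace α] [TopologicalSpace ι] :
    Subgroup (Ends α ι ≃ₜ Ends α ι) where
  carrier := {f | LocallyPrefix f}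
  one_mem' := fun _ => ⟨0, 0, by simp⟩
  mul_mem' := by
    intro g f hg hf x
    obtain ⟨m, k, h⟩ := hf x
    obtain ⟨m', k', h'⟩ := hg (f x)
    refine ⟨m' + m, k + k', ?_⟩
    filter_upwards [h, f.continuous.continuousAt.eventually h'] with y h1 h2
    rw [drop_add_congr h1, Nat.add_comm m' k, drop_add_congr h2]
    rfl
  inv_mem' := fun hf => LocallyPrefix.symm hf

lemma TailCompat.conj_mem {h : Ends α ι ≃ₜ Ends α κ} (H : TailCompat h)
    {f : Ends α ι ≃ₜ Ends α ι} (hf : f ∈ prefixGroup α ι) :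
    (h.symm.trans f).trans h ∈ prefixGroup α κ := by
  intro x
  obtain ⟨m, k, hm⟩ := hf (h.symm x)
  obtain ⟨M, K, HM⟩ := H _ _ m k hm.self_of_nhds
  refine ⟨M, K, ?_⟩
  have c : Continuous fun y => (h.symm y, f (h.symm y)) := by fun_prop
  filter_upwards [h.symm.continuous.continuousAt.eventually hm,
    c.continuousAt.eventually HM] with y h1 h2
  simpa using h2 h1

lemma TailEquivalent.nonempty_mulEquiv (H : TailEquivalent α ι κ) :
    Nonempty (prefixGroup α ι ≃* prefixGroup α κ) := by
  obtain ⟨h, h1, h2⟩ := H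
  refine ⟨{ toFun := fun f => ⟨(h.symm.trans f.1).trans h, h1.conj_mem f.2⟩
            invFun := fun f => ⟨(h.trans f.1).trans h.symm, h2.conj_mem f.2⟩
            left_inv := fun f => ?_, right_inv := fun f => ?_, map_mul' := fun f g => ?_ }⟩
  all_goals
    apply Subtype.ext
    ext1 x
    simp

lemma TailEquivalent.of_equiv [DiscreteTopology ι] [DiscreteTopology κ] (e : ι ≃ κ) :
    TailEquivalent α ι κ := by
  let h : Ends α ι ≃ₜ Ends α κ := (e.toHomeomorphOfDiscrete).prodCongr (Homeomorph.refl _)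
  exact LocallyPrefix.tailEquivalent (h := h) fun x => ⟨0, 0, by simp [h]⟩

lemma TailEquivalent.prod (η : Type*) [TopologicalSpace η] (H : TailEquivalent α ι κ) :
    TailEquivalent α (η × ι) (η × κ) := by
  obtain ⟨h, h1, h2⟩ := H
  exact ⟨{ toFun := fun x => ((x.1.1, (h (x.1.2, x.2)).1), (h (x.1.2, x.2)).2)
           invFun := fun x => ((x.1.1, (h.symm (x.1.2, x.2)).1), (h.symm (x.1.2, x.2)).2)
           left_inv := fun x => by simp
           right_inv := fun x => by simp
           continuous_toFun := by fun_prop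
           continuous_invFun := by fun_prop }, h1.prod η, h2.prod η⟩

end TailEquivalence

/-- Splitting one root into its children. -/
lemma tailEquivalent_expand {α ι : Type*} [TopologicalSpace α] [DiscreteTopology α]
    [TopologicalSpace ι] [DiscreteTopology ι] :
    TailEquivalent α (ι ⊕ α) (ι ⊕ Unit) := by
  let e : Ends α (ι ⊕ α) ≃ Ends α (ι ⊕ Unit) :=
    { toFun := fun x => match x with
        | (Sum.inl i, w) => (Sum.inl i, w)
        | (Sum.inr a, w) => (Sum.inr (), cat [a] w)
      invFun := fun x => match x with
        | (Sum.inl i, w) => (Sum.inl i, w)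
        | (Sum.inr _, w) => (Sum.inr (w 0), drop 1 w)
      left_inv := by
        rintro ⟨i | a, w⟩
        · rfl
        · exact congrArg (Prod.mk _) (drop_cat [a] w)
      right_inv := by
        rintro ⟨i | a, w⟩
        · rfl
        · exact congrArg (Prod.mk _) (cat_pre_drop 1 w) }
  have he : Continuous e := by
    rw [continuous_iff_continuousAt]
    rintro ⟨i | a, w⟩
    · have : Continuous fun x : Ends α (ι ⊕ α) => ((Sum.inl i, x.2) : Ends α (ι ⊕ Unit)) := by
        fun_prop
      refine this.continuousAt.congr ?_
      filter_upwards [eventually_cylinder (α := α) (ι := ι ⊕ α) (Sum.inl i, w) 0] with y hy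
      obtain ⟨b, z⟩ := y
      obtain rfl : b = Sum.inl i := hy.1
      rfl
    · have : Continuous fun x : Ends α (ι ⊕ α) =>
          ((Sum.inr (), cat [a] x.2) : Ends α (ι ⊕ Unit)) :=
        continuous_const.prodMk ((continuous_cat _).comp continuous_snd)
      refine this.continuousAt.congr ?_
      filter_upwards [eventually_cylinder (α := α) (ι := ι ⊕ α) (Sum.inr a, w) 0] with y hy
      obtain ⟨b, z⟩ := y
      obtain rfl : b = Sum.inr a := hy.1
      rfl
  have he' : Continuous e.symm := by
    rw [continuous_iff_continuousAt]
    rintro ⟨i | a, w⟩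
    · have : Continuous fun x : Ends α (ι ⊕ Unit) => ((Sum.inl i, x.2) : Ends α (ι ⊕ α)) := by
        fun_prop
      refine this.continuousAt.congr ?_
      filter_upwards [eventually_cylinder (α := α) (ι := ι ⊕ Unit) (Sum.inl i, w) 0] with y hy
      obtain ⟨b, z⟩ := y
      obtain rfl : b = Sum.inl i := hy.1
      rfl
    · have : Continuous fun x : Ends α (ι ⊕ Unit) =>
          ((Sum.inr (x.2 0), drop 1 x.2) : Ends α (ι ⊕ α)) :=
        (continuous_inr.comp ((continuous_apply 0).comp continuous_snd)).prodMk
          ((continuous_drop _).comp continuous_snd)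
      refine this.continuousAt.congr ?_
      filter_upwards [eventually_cylinder (α := α) (ι := ι ⊕ Unit) (Sum.inr a, w) 0] with y hy
      obtain ⟨b, z⟩ := y
      obtain rfl : b = Sum.inr a := hy.1
      rfl
  refine LocallyPrefix.tailEquivalent (h := ⟨e, he, he'⟩) ?_
  rintro ⟨i | a, w⟩
  · refine ⟨0, 0, ?_⟩
    filter_upwards [eventually_cylinder (α := α) (ι := ι ⊕ α) (Sum.inl i, w) 0] with y hy
    obtain ⟨b, z⟩ := y
    obtain rfl : b = Sum.inl i := hy.1
    rfl
  · refine ⟨0, 1, ?_⟩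
    filter_upwards [eventually_cylinder (α := α) (ι := ι ⊕ α) (Sum.inr a, w) 0] with y hy
    obtain ⟨b, z⟩ := y
    obtain rfl : b = Sum.inr a := hy.1
    exact (drop_cat [a] z).symm

section MaximalIsomorphisms

variable {n r : ℕ}

/-- `f` maps the cone below `u` to the cone below `v` by replacing the prefix. -/
def Carries (f : Ends (Fin n) (Fin r) → Ends (Fin n) (Fin r)) (u v : HTPt n r) : Prop :=
  ∀ w, f (u.1, cat u.2 w) = (v.1, cat v.2 w)

/-- The partial map on finite words induced by a map of end spaces. -/
noncomputable def toPFun (f : Ends (Fin n) (Fin r) → Ends (Fin n) (Fin r)) :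
    HTPt n r →. HTPt n r :=
  fun u => ⟨∃ v, Carries f u v, fun h => h.choose⟩

lemma Carries.unique [Nontrivial (Fin n)] {f : Ends (Fin n) (Fin r) → Ends (Fin n) (Fin r)}
    {u v v' : HTPt n r} (h : Carries f u v) (h' : Carries f u v') : v = v' := by
  have e : ∀ w, v.1 = v'.1 ∧ cat v.2 w = cat v'.2 w := fun w =>
    Prod.ext_iff.1 ((h w).symm.trans (h' w))
  exact Prod.ext (e fun _ => Classical.arbitrary _).1 (eq_of_forall_cat fun w => (e w).2)

lemma mem_toPFun [Nontrivial (Fin n)] {f : Ends (Fin n) (Fin r) → Ends (Fin n) (Fin r)}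
    {u v : HTPt n r} : v ∈ toPFun f u ↔ Carries f u v :=
  ⟨fun ⟨h, e⟩ => e ▸ h.choose_spec, fun h => ⟨⟨v, h⟩, (Exists.choose_spec ⟨v, h⟩).unique h⟩⟩

lemma Carries.act {f : Ends (Fin n) (Fin r) → Ends (Fin n) (Fin r)} {u v : HTPt n r}
    (h : Carries f u v) (t : List (Fin n)) : Carries f (HTact u t) (HTact v t) := fun w => by
  simpa [HTact, cat_append] using h (cat t w)

lemma Carries.symm {f : Ends (Fin n) (Fin r) ≃ₜ Ends (Fin n) (Fin r)} {u v : HTPt n r}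
    (h : Carries f u v) : Carries f.symm v u := fun w => by
  rw [← h w, f.symm_apply_apply]

lemma Carries.comp {f g : Ends (Fin n) (Fin r) → Ends (Fin n) (Fin r)} {u v z : HTPt n r}
    (h : Carries f u v) (h' : Carries g v z) : Carries (g ∘ f) u z := fun w => by
  rw [Function.comp, h w, h' w]

lemma IsCofinite.exists_pre {V : Set (HTPt n r)} (hV : IsCofinite V)
    (x : Ends (Fin n) (Fin r)) : ∃ m, (x.1, pre m x.2) ∈ V := by
  by_contra! h
  refine Set.infinite_of_injective_forall_mem (f := fun m => ((x.1, pre m x.2) : HTPt n r))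
    (fun m k e => ?_) h hV
  simpa using congrArg (fun u : HTPt n r => u.2.length) e

lemma isCofinite_of_exists_pre [Nontrivial (Fin n)] {V : Set (HTPt n r)}
    (hV : ∀ u ∈ V, ∀ w, HTact u w ∈ V)
    (h : ∀ x : Ends (Fin n) (Fin r), ∃ m, (x.1, pre m x.2) ∈ V) : IsCofinite V := by
  choose m hm using h
  obtain ⟨t, -, ht⟩ := isCompact_univ.elim_nhds_subcover
    (fun x : Ends (Fin n) (Fin r) => {y | y.1 = x.1 ∧ pre (m x) y.2 = pre (m x) x.2})
    (fun x _ => eventually_pre x (m x))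
  refine ((Set.finite_univ.prod (List.finite_length_lt (Fin n) (t.sup m)))).subset ?_
  rintro ⟨a, u⟩ hu
  refine ⟨trivial, ?_⟩
  by_contra hl
  refine hu ?_
  set w : ℕ → Fin n := fun _ => Classical.arbitrary (Fin n)
  obtain ⟨x, hxt, ha, hp⟩ : ∃ x ∈ t, a = x.1 ∧ pre (m x) (cat u w) = pre (m x) x.2 := by
    simpa using ht (Set.mem_univ ((a, cat u w) : Ends _ _))
  have hle : m x ≤ u.length := (Finset.le_sup hxt).trans (not_lt.1 hl)
  obtain ⟨s, hs, -⟩ := cat_eq_cat (u := pre (m x) x.2) (v := u)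
    (w := drop (m x) (cat u w)) (z := w) (by rw [← hp, cat_pre_drop]) (by simpa using hle)
  have := hV _ (hm x) s
  rwa [HTact, ← hs, ← ha] at this

lemma exists_carries {f : Ends (Fin n) (Fin r) ≃ₜ Ends (Fin n) (Fin r)}
    (hf : f ∈ prefixGroup (Fin n) (Fin r)) (x : Ends (Fin n) (Fin r)) :
    ∃ m v, Carries f (x.1, pre m x.2) v := by
  obtain ⟨m, k, h⟩ := hf x
  obtain ⟨l, hl⟩ := exists_cylinder
    (h.and (f.continuous.continuousAt.eventually (eventually_pre (f x) k)))
  refine ⟨l + m, ((f x).1, pre k (f x).2 ++ pre l (drop m x.2)), fun w => ?_⟩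
  have e : pre l (cat (pre (l + m) x.2) w) = pre l x.2 := by
    rw [pre_add, cat_append]
    exact pre_cat_of_length (length_pre _ _) _
  obtain ⟨h1, h2, h3⟩ := hl (x.1, cat (pre (l + m) x.2) w) rfl e
  refine Prod.ext h2 ?_
  rw [← cat_pre_drop k (f _).2, h3, ← h1, cat_append]
  dsimp only
  congr 1
  have : pre (l + m) x.2 = pre m x.2 ++ pre l (drop m x.2) := by rw [Nat.add_comm, pre_add]
  rw [this, cat_append]
  exact drop_cat_of_length (length_pre m x.2) _

lemma isSubspace_dom_toPFun [Nontrivial (Fin n)] [NeZero r]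
    {f : Ends (Fin n) (Fin r) ≃ₜ Ends (Fin n) (Fin r)} (hf : f ∈ prefixGroup (Fin n) (Fin r)) :
    IsSubspace (toPFun f).Dom ∧ IsCofinite (toPFun f).Dom := by
  have h1 : ∀ u ∈ (toPFun f).Dom, ∀ w, HTact u w ∈ (toPFun f).Dom :=
    fun u ⟨v, h⟩ w => ⟨_, h.act w⟩
  obtain ⟨m, h⟩ := exists_carries hf (0, fun _ => Classical.arbitrary _)
  exact ⟨⟨⟨_, h⟩, h1⟩, isCofinite_of_exists_pre h1 (exists_carries hf)⟩

lemma ran_toPFun [Nontrivial (Fin n)] (f : Ends (Fin n) (Fin r) ≃ₜ Ends (Fin n) (Fin r)) :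
    (toPFun f).ran = (toPFun f.symm).Dom := by
  ext v
  exact ⟨fun ⟨u, h⟩ => ⟨u, (mem_toPFun.1 h).symm⟩,
    fun ⟨u, h⟩ => ⟨u, mem_toPFun.2 h.symm⟩⟩

lemma isCofIso_toPFun [Nontrivial (Fin n)] [NeZero r]
    {f : Ends (Fin n) (Fin r) ≃ₜ Ends (Fin n) (Fin r)} (hf : f ∈ prefixGroup (Fin n) (Fin r)) :
    IsCofIso (toPFun f) := by
  obtain ⟨h1, h2⟩ := isSubspace_dom_toPFun hf
  obtain ⟨h3, h4⟩ := isSubspace_dom_toPFun (inv_mem hf)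
  refine ⟨h1, h2, ?_, ?_, ?_, ?_⟩
  · rwa [ran_toPFun]
  · rwa [ran_toPFun]
  · intro u v h w
    exact mem_toPFun.2 ((mem_toPFun.1 h).act w)
  · intro u u' v h h'
    exact (mem_toPFun.1 h).symm.unique (mem_toPFun.1 h').symm

/-- The relation on ends induced by a relation on finite words. -/
def EndRel (R : HTPt n r → HTPt n r → Prop) (x y : Ends (Fin n) (Fin r)) : Prop :=
  ∃ u v w, R u v ∧ x = (u.1, cat u.2 w) ∧ y = (v.1, cat v.2 w)

lemma EndRel.unique {R : HTPt n r → HTPt n r → Prop}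
    (hR : ∀ u v, R u v → ∀ w, R (HTact u w) (HTact v w))
    (hu : ∀ u v v', R u v → R u v' → v = v') {x y y' : Ends (Fin n) (Fin r)}
    (h : EndRel R x y) (h' : EndRel R x y') : y = y' := by
  obtain ⟨u, v, w, huv, hx, rfl⟩ := h
  obtain ⟨u', v', w', huv', hx', rfl⟩ := h'
  obtain ⟨e1, e2⟩ := Prod.ext_iff.1 (hx.symm.trans hx')
  dsimp only at e1 e2
  wlog hl : u.2.length ≤ u'.2.length generalizing u v w u' v' w'
  · exact (this u' v' w' huv' hx' u v w huv hx e1.symm e2.symm (by omega)).symm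
  obtain ⟨t, ht, hw⟩ := cat_eq_cat e2 hl
  have e : u' = HTact u t := Prod.ext e1.symm ht
  have := hu _ _ _ huv' (e ▸ hR _ _ huv t)
  rw [this, hw, HTact, cat_append]

lemma EndRel.exists {R : HTPt n r → HTPt n r → Prop} (hc : IsCofinite {u | ∃ v, R u v})
    (x : Ends (Fin n) (Fin r)) : ∃ y, EndRel R x y := by
  obtain ⟨m, v, h⟩ := IsCofinite.exists_pre hc x
  exact ⟨_, _, v, drop m x.2, h, by simp [cat_pre_drop], rfl⟩

lemma EndRel.swap {R : HTPt n r → HTPt n r → Prop} {x y : Ends (Fin n) (Fin r)}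
    (h : EndRel R x y) : EndRel (fun u v => R v u) y x :=
  let ⟨u, v, w, h, hx, hy⟩ := h
  ⟨v, u, w, h, hy, hx⟩

lemma EndRel.eventually {R : HTPt n r → HTPt n r → Prop}
    {f : Ends (Fin n) (Fin r) → Ends (Fin n) (Fin r)} (hf : ∀ x y, EndRel R x y → f x = y)
    (hc : IsCofinite {u | ∃ v, R u v}) (x : Ends (Fin n) (Fin r)) :
    ∃ (m : ℕ) (v : HTPt n r), ∀ᶠ y in 𝓝 x, f y = (v.1, cat v.2 (drop m y.2)) := by
  obtain ⟨m, v, h⟩ := IsCofinite.exists_pre hc x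
  refine ⟨m, v, ?_⟩
  filter_upwards [eventually_pre x m] with y ⟨hy1, hy2⟩
  exact hf _ _ ⟨_, v, drop m y.2, h, by simp [← hy1, ← hy2, cat_pre_drop], rfl⟩

lemma continuous_of_endRel {R : HTPt n r → HTPt n r → Prop}
    {f : Ends (Fin n) (Fin r) → Ends (Fin n) (Fin r)} (hf : ∀ x y, EndRel R x y → f x = y)
    (hc : IsCofinite {u | ∃ v, R u v}) : Continuous f := by
  refine continuous_iff_continuousAt.2 fun x => ?_
  obtain ⟨m, v, h⟩ := EndRel.eventually hf hc x
  refine ContinuousAt.congr ?_ (h.mono fun _ => Eq.symm)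
  exact (continuous_const.prodMk ((continuous_cat _).comp
    ((continuous_drop m).comp continuous_snd))).continuousAt

lemma exists_mem_prefixGroup {φ : HTPt n r →. HTPt n r} (hφ : IsCofIso φ) :
    ∃ f ∈ prefixGroup (Fin n) (Fin r), ∀ u v, v ∈ φ u → Carries f u v := by
  obtain ⟨-, h1, -, h2, h3, h4⟩ := hφ
  have u1 : ∀ {x y y'}, EndRel (fun u v => v ∈ φ u) x y → EndRel (fun u v => v ∈ φ u) x y' →
      y = y' :=
    EndRel.unique h3 fun _ _ _ => Part.mem_unique
  have u2 : ∀ {x y y'}, EndRel (fun v u => v ∈ φ u) x y → EndRel (fun v u => v ∈ φ u) x y' →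
      y = y' :=
    EndRel.unique (fun u v h => h3 v u h) fun _ _ _ h h' => h4 _ _ _ h h'
  have c1 : IsCofinite {u | ∃ v, v ∈ φ u} := by
    simpa only [← PFun.mem_dom, Set.ofPred_mem_eq] using h1
  choose f hf using fun x => EndRel.exists c1 x
  choose g hg using fun x => EndRel.exists (R := fun v u => v ∈ φ u) h2 x
  let F : Ends (Fin n) (Fin r) ≃ₜ Ends (Fin n) (Fin r) :=
    { toFun := f
      invFun := g
      left_inv := fun x => u2 (hg _) (hf x).swap
      right_inv := fun x => u1 (hf _) (hg x).swap
      continuous_toFun := continuous_of_endRel (fun x y h => u1 (hf x) h) c1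
      continuous_invFun := continuous_of_endRel (fun x y h => u2 (hg x) h) h2 }
  refine ⟨F, fun x => ?_, fun u v h w => u1 (hf _) ⟨u, v, w, h, rfl, rfl⟩⟩
  obtain ⟨m, v, h⟩ := EndRel.eventually (fun x y h => u1 (hf x) h) c1 x
  refine ⟨m, v.2.length, h.mono fun y hy => ?_⟩
  change _ = drop _ (f y).2
  rw [hy, drop_cat]

lemma eq_of_carries {φ : HTPt n r →. HTPt n r} (hφ : IsCofinite φ.Dom)
    {f g : Ends (Fin n) (Fin r) → Ends (Fin n) (Fin r)}
    (hf : ∀ u v, v ∈ φ u → Carries f u v) (hg : ∀ u v, v ∈ φ u → Carries g u v) : f = g := by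
  funext x
  obtain ⟨m, hm⟩ := IsCofinite.exists_pre hφ x
  obtain ⟨z, hz⟩ := (PFun.mem_dom _ _).1 hm
  simpa [cat_pre_drop] using (hf _ _ hz (drop m x.2)).trans (hg _ _ hz (drop m x.2)).symm

lemma isMaxCofIso_toPFun [Nontrivial (Fin n)] [NeZero r]
    {f : Ends (Fin n) (Fin r) ≃ₜ Ends (Fin n) (Fin r)} (hf : f ∈ prefixGroup (Fin n) (Fin r)) :
    IsMaxCofIso (toPFun f) := by
  refine ⟨isCofIso_toPFun hf, fun φ hφ h => PFun.ext fun u v => ⟨fun huv => ?_, h u v⟩⟩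
  obtain ⟨g, -, hg⟩ := exists_mem_prefixGroup hφ
  have : (g : Ends (Fin n) (Fin r) → Ends (Fin n) (Fin r)) = f :=
    eq_of_carries (isCofIso_toPFun hf).2.1 (fun u v h' => hg u v (h u v h'))
      fun _ _ => mem_toPFun.1
  exact mem_toPFun.2 (this ▸ hg u v huv)

lemma IsMaxCofIso.exists_eq_toPFun [Nontrivial (Fin n)] [NeZero r] {φ : HTPt n r →. HTPt n r}
    (hφ : IsMaxCofIso φ) :
    ∃ f ∈ prefixGroup (Fin n) (Fin r), φ = toPFun f :=
  let ⟨f, hf, h⟩ := exists_mem_prefixGroup hφ.1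
  ⟨f, hf, (hφ.2 _ (isCofIso_toPFun hf) fun u v huv => mem_toPFun.2 (h u v huv)).symm⟩

lemma isCofinite_dom_comp [Nontrivial (Fin n)] [NeZero r]
    {f g : Ends (Fin n) (Fin r) ≃ₜ Ends (Fin n) (Fin r)}
    (hf : f ∈ prefixGroup (Fin n) (Fin r)) (hg : g ∈ prefixGroup (Fin n) (Fin r)) :
    IsCofinite (PFun.comp (toPFun g) (toPFun f)).Dom := by
  have key : ∀ u v z, Carries f u v → Carries g v z →
      u ∈ (PFun.comp (toPFun g) (toPFun f)).Dom := fun u v z h h' =>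
    (PFun.mem_dom _ _).2 ⟨z, Part.mem_bind (mem_toPFun.2 h) (mem_toPFun.2 h')⟩
  refine isCofinite_of_exists_pre (fun u hu w => ?_) fun x => ?_
  · obtain ⟨z, hz⟩ := (PFun.mem_dom _ _).1 hu
    obtain ⟨v, h, h'⟩ := Part.mem_bind_iff.1 hz
    exact key _ _ _ ((mem_toPFun.1 h).act w) ((mem_toPFun.1 h').act w)
  · obtain ⟨m, v, h⟩ := exists_carries hf x
    obtain ⟨k, z, h'⟩ := exists_carries hg (v.1, cat v.2 (drop m x.2))
    have h2 := h.act (pre k (drop m x.2))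
    have e : HTact (x.1, pre m x.2) (pre k (drop m x.2)) = (x.1, pre (m + k) x.2) := by
      rw [HTact, pre_add]
    rw [e] at h2
    refine ⟨m + k, key _ _ (HTact z (pre v.2.length (drop k (cat v.2 (drop m x.2))))) h2 ?_⟩
    convert h'.act _ using 1
    refine Prod.ext rfl ?_
    change _ = pre _ _ ++ pre _ _
    rw [← pre_add, Nat.add_comm, pre_add, pre_cat, drop_cat]
    rfl

theorem nonempty_prefixGroup_mulEquiv [Nontrivial (Fin n)] [NeZero r] [Group (HT n r)]
    (hmul : IsHTMul n r (· * ·)) : Nonempty (prefixGroup (Fin n) (Fin r) ≃* HT n r) := by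
  let E (f : prefixGroup (Fin n) (Fin r)) : HT n r := ⟨toPFun (f⁻¹).1, isMaxCofIso_toPFun (f⁻¹).2⟩
  have hE : ∀ f g, E (f * g) = E f * E g := by
    intro f g
    obtain ⟨k, hk, h⟩ := IsMaxCofIso.exists_eq_toPFun (E f * E g).2
    refine Subtype.ext (Eq.trans ?_ h.symm)
    have := hmul (E f) (E g)
    refine congrArg toPFun (eq_of_carries (isCofinite_dom_comp (f⁻¹).2 (g⁻¹).2)
      (fun u z hz => ?_) fun u z hz => ?_)
    · obtain ⟨v, h, h'⟩ := Part.mem_bind_iff.1 hz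
      have := (mem_toPFun.1 h).comp (mem_toPFun.1 h')
      rw [mul_inv_rev]
      exact this
    · exact mem_toPFun.1 (h ▸ this u z hz)
  refine ⟨MulEquiv.ofBijective (MulHom.mk E hE) ⟨fun f g h => ?_, fun φ => ?_⟩⟩
  · have h : toPFun (f⁻¹).1 = toPFun (g⁻¹).1 := congrArg Subtype.val h
    refine inv_injective (Subtype.ext (Homeomorph.ext (congrFun ?_)))
    exact eq_of_carries (isCofIso_toPFun (f⁻¹).2).2.1 (fun _ _ => mem_toPFun.1)
      fun u v huv => mem_toPFun.1 (h ▸ huv)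
  · obtain ⟨f, hf, h⟩ := IsMaxCofIso.exists_eq_toPFun φ.2
    refine ⟨⟨f, hf⟩⁻¹, Subtype.ext ?_⟩
    rw [h]
    change toPFun ((⟨f, hf⟩ : prefixGroup (Fin n) (Fin r))⁻¹⁻¹).1 = _
    rw [inv_inv]

end MaximalIsomorphisms

/-- `Run A V a u c`: reading the word `u` from state `a` leads to state `c`. -/
inductive Run {α δ : Type*} (A : α → δ → δ) (V : α → δ → List α) : δ → List α → δ → Prop
  | refl (a : δ) : Run A V a [] a
  | step (i : α) (c : δ) {u : List α} {e : δ} (h : Run A V c u e) : Run A V (A i c) (V i c ++ u) e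

lemma Run.trans {A : α → δ → δ} {V : α → δ → List α} {a c e : δ} {u v : List α}
    (h : Run A V a u c) (h' : Run A V c v e) : Run A V a (u ++ v) e := by
  induction h with
  | refl => exact h'
  | step i c _ ih => rw [List.append_assoc]; exact (ih h').step i c

section Transducers

variable {α δ : Type*} [TopologicalSpace α] [TopologicalSpace δ]

/-- The state reached after one step of the transducer inverse to `Φ`. -/
def shift (Φ : α × Ends α δ ≃ₜ Ends α δ) (x : Ends α δ) : Ends α δ := (Φ.symm x).2

/-- The sequence of letters emitted by the transducer inverse to `Φ`. -/
def itinerary (Φ : α × Ends α δ ≃ₜ Ends α δ) (x : Ends α δ) : ℕ → α :=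
  fun k => (Φ.symm ((shift Φ)^[k] x)).1

variable (Φ : α × Ends α δ ≃ₜ Ends α δ)

lemma itinerary_iterate (m : ℕ) (x : Ends α δ) :
    itinerary Φ ((shift Φ)^[m] x) = drop m (itinerary Φ x) := by
  funext k
  simp only [itinerary, drop, ← Function.iterate_add_apply, Nat.add_comm]

lemma continuous_shift : Continuous (shift Φ) := continuous_snd.comp Φ.symm.continuous

lemma continuous_itinerary : Continuous (itinerary Φ) :=
  continuous_pi fun k => continuous_fst.comp
    (Φ.symm.continuous.comp ((continuous_shift Φ).iterate k))

lemma apply_shift (x : Ends α δ) : Φ (itinerary Φ x 0, shift Φ x) = x := Φ.apply_symm_apply x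

lemma apply_iterate_shift (k : ℕ) (x : Ends α δ) :
    Φ (itinerary Φ x k, (shift Φ)^[k + 1] x) = (shift Φ)^[k] x := by
  rw [Function.iterate_succ_apply']
  exact Φ.apply_symm_apply _

lemma itinerary_apply (i : α) (x : Ends α δ) :
    itinerary Φ (Φ (i, x)) = fun k => Nat.casesOn k i (itinerary Φ x) := by
  funext k
  cases k with
  | zero => simp [itinerary]
  | succ k => simp [itinerary, shift]

lemma surjective_itinerary [Nonempty δ] [Finite α] [DiscreteTopology α] [Finite δ]
    [DiscreteTopology δ] : Surjective (itinerary Φ) := by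
  intro s
  have hne : ∀ (N : ℕ) (s : ℕ → α), ∃ x, ∀ k < N, itinerary Φ x k = s k := by
    intro N
    induction N with
    | zero => exact fun s => ⟨(Classical.arbitrary δ, s), by simp⟩
    | succ N ih =>
      intro s
      obtain ⟨x, hx⟩ := ih (drop 1 s)
      refine ⟨Φ (s 0, x), fun k hk => ?_⟩
      rw [itinerary_apply]
      cases k with
      | zero => rfl
      | succ k => simpa [drop, Nat.add_comm] using hx k (by omega)
  have hcl : ∀ N, IsClosed {x | ∀ k < N, itinerary Φ x k = s k} := by
    intro N
    simp only [Set.ofPred_forall]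
    exact isClosed_iInter fun k => isClosed_iInter fun _ =>
      isClosed_eq ((continuous_apply k).comp (continuous_itinerary Φ)) continuous_const
  obtain ⟨x, hx⟩ := IsCompact.nonempty_iInter_of_sequence_nonempty_isCompact_isClosed
    (fun N => {x | ∀ k < N, itinerary Φ x k = s k})
    (fun N x hx k hk => hx k (by omega)) (fun N => hne N s) (hcl 0).isCompact hcl
  exact ⟨x, funext fun k => Set.mem_iInter.1 hx (k + 1) k (by omega)⟩

variable {Φ} {A : α → δ → δ} {V : α → δ → List α}

lemma Run.exists_iterate (hΦ : ∀ i x, Φ (i, x) = (A i x.1, cat (V i x.1) x.2)) {a c : δ}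
    {u : List α} (h : Run A V a u c) : ∃ M, ∀ z, (shift Φ)^[M] (a, cat u z) = (c, z) := by
  induction h with
  | refl a => exact ⟨0, by simp⟩
  | step i c _ ih =>
    obtain ⟨M, hM⟩ := ih
    refine ⟨M + 1, fun z => ?_⟩
    rw [Function.iterate_succ_apply, cat_append, ← hM z]
    congr 1
    rw [shift, Φ.symm_apply_eq.2 (hΦ i (c, _)).symm]

lemma injective_itinerary (hΦ : ∀ i x, Φ (i, x) = (A i x.1, cat (V i x.1) x.2))
    (hroot : ∀ (i : ℕ → α) (a b : ℕ → δ), (∀ k, a k = A (i k) (a (k + 1))) →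
      (∀ k, b k = A (i k) (b (k + 1))) → a 0 = b 0)
    (hword : ∀ (i : ℕ → α) (a : ℕ → δ), (∀ k, a k = A (i k) (a (k + 1))) →
      ∃ k, V (i k) (a (k + 1)) ≠ []) : Injective (itinerary Φ) := by
  intro x y hxy
  have step : ∀ z k, (shift Φ)^[k] z = (A (itinerary Φ z k) ((shift Φ)^[k + 1] z).1,
      cat (V (itinerary Φ z k) ((shift Φ)^[k + 1] z).1) ((shift Φ)^[k + 1] z).2) :=
    fun z k => (apply_iterate_shift Φ k z).symm.trans (hΦ _ _)
  have hab : ∀ m, ((shift Φ)^[m] x).1 = ((shift Φ)^[m] y).1 := fun m =>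
    hroot (fun k => itinerary Φ x (m + k)) (fun k => ((shift Φ)^[m + k] x).1)
      (fun k => ((shift Φ)^[m + k] y).1) (fun k => congrArg Prod.fst (step x (m + k)))
      (fun k => hxy ▸ congrArg Prod.fst (step y (m + k)))
  set v : ℕ → List α := fun k => V (itinerary Φ x k) ((shift Φ)^[k + 1] x).1 with hv
  have hu : ∀ N, ∃ u : List α, u.length = ∑ k ∈ Finset.range N, (v k).length ∧
      x.2 = cat u ((shift Φ)^[N] x).2 ∧ y.2 = cat u ((shift Φ)^[N] y).2 := by
    intro N
    induction N with
    | zero => exact ⟨[], by simp, by simp [cat_nil], by simp [cat_nil]⟩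
    | succ N ih =>
      obtain ⟨u, h1, h2, h3⟩ := ih
      refine ⟨u ++ v N, by simp [h1, Finset.sum_range_succ], ?_, ?_⟩
      · rw [h2, cat_append]
        exact congrArg (cat u) (congrArg Prod.snd (step x N))
      · rw [h3, cat_append, hv, hxy]
        dsimp only
        rw [hab]
        exact congrArg (cat u) (congrArg Prod.snd (step y N))
  have hL : ∀ L, ∃ N, L ≤ ∑ k ∈ Finset.range N, (v k).length := by
    intro L
    induction L with
    | zero => exact ⟨0, by simp⟩
    | succ L ih =>
      obtain ⟨N, hN⟩ := ih
      obtain ⟨k, hk⟩ := hword (fun k => itinerary Φ x (N + k)) (fun k => ((shift Φ)^[N + k] x).1)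
        (fun k => congrArg Prod.fst (step x (N + k)))
      refine ⟨N + k + 1, ?_⟩
      have h1 : 0 < (v (N + k)).length := List.length_pos_iff.2 hk
      have h2 : ∑ k ∈ Finset.range N, (v k).length ≤ ∑ k ∈ Finset.range (N + k), (v k).length :=
        Finset.sum_le_sum_of_subset (Finset.range_subset_range.2 (by omega))
      rw [Finset.sum_range_succ]
      omega
  refine Prod.ext (hab 0) (funext fun j => ?_)
  obtain ⟨N, hN⟩ := hL (j + 1)
  obtain ⟨u, h1, h2, h3⟩ := hu N
  have hj : j < u.length := by omega
  rw [h2, h3]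
  exact cat_apply_of_lt _ _ hj

variable [DiscreteTopology α] [DiscreteTopology δ]

lemma eventually_drop_eq_iterate_shift
    (hΦ : ∀ i x, Φ (i, x) = (A i x.1, cat (V i x.1) x.2)) (m : ℕ) (x : Ends α δ) :
    ∃ M, ∀ᶠ y in 𝓝 x, drop M y.2 = ((shift Φ)^[m] y).2 := by
  induction m generalizing x with
  | zero => exact ⟨0, by simp⟩
  | succ m ih =>
    obtain ⟨M, hM⟩ := ih (shift Φ x)
    refine ⟨M + (V (itinerary Φ x 0) (shift Φ x).1).length, ?_⟩
    have h1 : ∀ᶠ y in 𝓝 x, itinerary Φ y 0 = itinerary Φ x 0 :=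
      ((isOpen_discrete {itinerary Φ x 0}).preimage
        ((continuous_apply 0).comp (continuous_itinerary Φ))).mem_nhds rfl
    have h2 : ∀ᶠ y in 𝓝 x, (shift Φ y).1 = (shift Φ x).1 :=
      ((isOpen_discrete {(shift Φ x).1}).preimage
        (continuous_fst.comp (continuous_shift Φ))).mem_nhds rfl
    filter_upwards [h1, h2, (continuous_shift Φ).continuousAt.eventually hM] with y h1 h2 h3
    rw [Function.iterate_succ_apply, ← h3, ← drop_drop, ← h1, ← h2]
    have e := apply_shift Φ y
    rw [hΦ] at e
    exact congrArg (drop M) ((congrArg (drop _) (congrArg Prod.snd e).symm).trans (drop_cat _ _))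

theorem tailEquivalent_of_transducer [Finite α] [Finite δ] [Nonempty δ]
    (hΦ : ∀ i x, Φ (i, x) = (A i x.1, cat (V i x.1) x.2))
    (hroot : ∀ (i : ℕ → α) (a b : ℕ → δ), (∀ k, a k = A (i k) (a (k + 1))) →
      (∀ k, b k = A (i k) (b (k + 1))) → a 0 = b 0)
    (hword : ∀ (i : ℕ → α) (a : ℕ → δ), (∀ k, a k = A (i k) (a (k + 1))) →
      ∃ k, V (i k) (a (k + 1)) ≠ [])
    (hmerge : ∀ a u a' u' w, ∃ l c, Run A V a (u ++ pre l w) c ∧ Run A V a' (u' ++ pre l w) c) :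
    TailEquivalent α δ Unit := by
  have hinj := injective_itinerary hΦ hroot hword
  let I : Ends α δ ≃ₜ Ends α Unit :=
    (Continuous.homeoOfEquivCompactToT2
      (f := Equiv.ofBijective (itinerary Φ) ⟨hinj, surjective_itinerary Φ⟩)
      (continuous_itinerary Φ)).trans (Homeomorph.punitProd _).symm
  have hI : ∀ x, (I x).2 = itinerary Φ x := fun _ => rfl
  have hI' : ∀ x, itinerary Φ (I.symm x) = x.2 := fun x => by rw [← hI, I.apply_symm_apply]
  refine ⟨I, fun x x' m k e => ?_, fun x x' m k e => ?_⟩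
  · obtain ⟨l, c, h, h'⟩ := hmerge x.1 (pre m x.2) x'.1 (pre k x'.2) (drop m x.2)
    obtain ⟨M, h⟩ := h.exists_iterate hΦ
    obtain ⟨M', h'⟩ := h'.exists_iterate hΦ
    refine ⟨M, M', ?_⟩
    filter_upwards [(eventually_pre x (m + l)).prod_nhds (eventually_pre x' (k + l))]
      with ⟨y, y'⟩ ⟨⟨h1, h2⟩, h3, h4⟩ h5
    simp only [hI, ← itinerary_iterate]
    congr 1
    have e1 : y = (x.1, cat (pre m x.2 ++ pre l (drop m x.2)) (drop (m + l) y.2)) := by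
      rw [← pre_add, ← h2, cat_pre_drop, ← h1]
    have e2 : y' = (x'.1, cat (pre k x'.2 ++ pre l (drop m x.2)) (drop (k + l) y'.2)) := by
      rw [e, ← pre_add, ← h4, cat_pre_drop, ← h3]
    rw [e1, e2, h, h']
    exact Prod.ext rfl (by simpa only [Nat.add_comm] using drop_add_congr h5 l)
  · obtain ⟨M, hM⟩ := eventually_drop_eq_iterate_shift hΦ m (I.symm x)
    obtain ⟨K, hK⟩ := eventually_drop_eq_iterate_shift hΦ k (I.symm x')
    refine ⟨M, K, ?_⟩
    filter_upwards [(I.symm.continuous.continuousAt.eventually hM).prod_nhds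
      (I.symm.continuous.continuousAt.eventually hK)] with ⟨y, y'⟩ ⟨h1, h2⟩ h3
    dsimp only at h1 h2 h3 ⊢
    rw [h1, h2]
    congr 1
    refine hinj ?_
    rw [itinerary_iterate, itinerary_iterate, hI', hI', h3]

end Transducers

section Counting

open scoped Classical in
lemma exists_equiv_iff {S T : Type*} [Fintype S] [Fintype T] {P : S → Prop} {Q : T → Prop}
    (h : Fintype.card S = Fintype.card T)
    (h' : Fintype.card {x // P x} = Fintype.card {x // Q x}) :
    ∃ e : S ≃ T, ∀ x, Q (e x) ↔ P x := by
  have h'' : Fintype.card {x // ¬ P x} = Fintype.card {x // ¬ Q x} := by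
    rw [Fintype.card_subtype_compl, Fintype.card_subtype_compl, h, h']
  let e₁ := Fintype.equivOfCardEq h'
  let e₂ := Fintype.equivOfCardEq h''
  refine ⟨(Equiv.sumCompl P).symm.trans ((e₁.sumCongr e₂).trans (Equiv.sumCompl Q)), fun x => ?_⟩
  by_cases hx : P x
  · simpa [hx] using (e₁ ⟨x, hx⟩).2
  · simpa [hx] using (e₂ ⟨x, hx⟩).2

/-- Some multiple of `d` lies in the interval `[a * p, (a + 1) * p)`. -/
def CrossesMultiple (d p a : ℕ) : Prop := ∃ t < p, d ∣ a * p + t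

open scoped Classical in
lemma card_crossesMultiple {d p : ℕ} (hp : p < d) (N : ℕ) :
    ∑ a ∈ Finset.range N, (if CrossesMultiple d p a then 1 else 0) = (N * p + (d - 1)) / d := by
  have hd : 0 < d := by omega
  induction N with
  | zero => simp [Nat.div_eq_of_lt (Nat.sub_lt hd one_pos)]
  | succ N ih =>
    rw [Finset.sum_range_succ, ih]
    set k := (N * p + (d - 1)) / d with hk
    have h1 : d * k ≤ N * p + (d - 1) := Nat.mul_div_le _ _
    have h2 : N * p + (d - 1) < d * (k + 1) := Nat.lt_mul_div_succ _ hd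
    symm
    have e1 : d * (k + 1) = d * k + d := by ring
    have e2 : (N + 1) * p = N * p + p := by ring
    split_ifs with h
    · obtain ⟨t, ht, c, hc⟩ := h
      have hkc : k ≤ c := by
        by_contra! hlt
        have : d * (c + 1) ≤ d * k := Nat.mul_le_mul_left d hlt
        have : d * (c + 1) = d * c + d := by ring
        omega
      have : d * k ≤ d * c := Nat.mul_le_mul_left d hkc
      have : d * (k + 1 + 1) = d * k + d + d := by ring
      refine Nat.div_eq_of_lt_le ?_ ?_ <;> rw [Nat.mul_comm _ d] <;> omega
    · change _ = k
      refine Nat.div_eq_of_lt_le ?_ ?_ <;> rw [Nat.mul_comm _ d]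
      · omega
      · by_contra! hlt
        exact h ⟨d * k - N * p, by omega, k, by omega⟩

end Counting

section Machine

variable {ν D p q : ℕ}

/-- The state map of the transducer: a truncated rotation by `n - 1 = ν + 1` on
`d = D + 1` states. -/
def nextState (i : Fin (ν + 2)) (c : Fin (D + 1)) : Fin (D + 1) :=
  if i = 0 then ⟨c - (ν + 1), by omega⟩
  else if i = 1 then ⟨min (c + (D - ν)) D, by omega⟩ else Fin.last D

/-- The pairs mapped to the last state by `nextState`. -/
def IsSlot (x : Fin (ν + 2) × Fin (D + 1)) : Prop := x.1 ≠ 0 ∧ (x.1 = 1 → ν ≤ x.2)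

instance : DecidablePred (IsSlot (ν := ν) (D := D)) := fun _ =>
  inferInstanceAs (Decidable (_ ∧ _))

/-- The leaves of the tree obtained from the root by expanding `D` times along the letter `0`. -/
abbrev Token (ν D : ℕ) := Option (Fin D × Fin (ν + 1))

/-- The word spelled by a leaf. -/
def Token.word : Token ν D → List (Fin (ν + 2))
  | none => List.replicate D 0
  | some (k, j) => List.replicate k 0 ++ [j.succ]

/-- The class of a leaf is determined by its last letter. -/
def Token.Crosses (d p : ℕ) : Token ν D → Prop
  | none => True
  | some (_, j) => CrossesMultiple d p (j + 1)

/-- The word written by the transducer. -/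
def output (e : {x : Fin (ν + 2) × Fin (D + 1) // IsSlot x} ≃ Token ν D) (i : Fin (ν + 2))
    (c : Fin (D + 1)) : List (Fin (ν + 2)) :=
  if h : IsSlot (i, c) then (e ⟨(i, c), h⟩).word
  else if h : c < ν + 2 ∧ i = 0 then [⟨c, h.1⟩] else []

lemma sum_slot (f : ℕ → ℕ) (hν : ν ≤ D + 1) :
    ∑ x : Fin (ν + 2) × Fin (D + 1), (if IsSlot x then f x.2 else 0) +
      ∑ a ∈ Finset.range ν, f a = (ν + 1) * ∑ a ∈ Finset.range (D + 1), f a := by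
  have h1 : ∑ c : Fin (D + 1), (if ν ≤ c then f c else 0) + ∑ a ∈ Finset.range ν, f a =
      ∑ a ∈ Finset.range (D + 1), f a := by
    rw [Fin.sum_univ_eq_sum_range (fun c => if ν ≤ c then f c else 0),
      ← Finset.sum_range_add_sum_Ico f hν, Nat.add_comm, ← Finset.sum_filter]
    congr 2
    ext a
    simp; omega
  rw [Fintype.sum_prod_type, Fin.sum_univ_succ (n := ν + 1), Fin.sum_univ_succ (n := ν)]
  have h2 : ∀ i : Fin ν, ∑ c : Fin (D + 1), (if IsSlot (i.succ.succ, c) then f c else 0) =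
      ∑ a ∈ Finset.range (D + 1), f a := by
    intro i
    rw [← Fin.sum_univ_eq_sum_range]
    refine Finset.sum_congr rfl fun c _ => if_pos ⟨Fin.succ_ne_zero i.succ, fun h => ?_⟩
    simp [Fin.ext_iff] at h
  have h3 : ∀ c : Fin (D + 1), IsSlot ((0 : Fin (ν + 1)).succ, c) ↔ ν ≤ c := by
    intro c; simp [IsSlot]
  simp only [h2, h3]
  simp only [IsSlot]
  simp
  linarith

lemma sum_token (f : ℕ → ℕ) :
    ∑ t : Token ν D, (match t with | none => 1 | some (_, j) => f (j + 1)) + D * f 0 =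
      1 + D * ∑ a ∈ Finset.range (ν + 2), f a := by
  rw [Fintype.sum_option, Fintype.sum_prod_type, Finset.sum_range_succ']
  simp [Fin.sum_univ_eq_sum_range (fun j => f (j + 1))]
  ring

lemma exists_slot_equiv (hν : ν + 1 ≤ D) (hp : p ≤ D) (hpq : p * (ν + 1) = q * (D + 1) + 1) :
    ∃ e : {x : Fin (ν + 2) × Fin (D + 1) // IsSlot x} ≃ Token ν D,
      ∀ x, (e x).Crosses (D + 1) p ↔ CrossesMultiple (D + 1) p x.1.2 := by
  classical
  refine exists_equiv_iff ?_ ?_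
  · have h1 := sum_slot (ν := ν) (D := D) (fun _ => 1) (by omega)
    have h2 := sum_token (ν := ν) (D := D) (fun _ => 1)
    rw [Fintype.card_subtype, Finset.card_filter]
    rw [← Finset.card_univ, Finset.card_eq_sum_ones]
    have h3 : ∑ t : Token ν D, (match t with | none => 1 | some (_, j) => 1) =
      ∑ t : Token ν D, 1 := Finset.sum_congr rfl fun t _ => by cases t <;> rfl
    rw [h3] at h2
    simp only [Finset.sum_const, Finset.card_range, smul_eq_mul, mul_one] at h1 h2 ⊢
    nlinarith
  · have h1 := sum_slot (ν := ν) (D := D)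
      (fun a => if CrossesMultiple (D + 1) p a then 1 else 0) (by omega)
    have h2 := sum_token (ν := ν) (D := D)
      (fun a => if CrossesMultiple (D + 1) p a then 1 else 0)
    have h0 : CrossesMultiple (D + 1) p 0 :=
      ⟨0, Nat.pos_of_ne_zero (by rintro rfl; simp at hpq), by simp⟩
    simp only [card_crossesMultiple (d := D + 1) (p := p) (by omega), if_pos h0,
      Nat.add_sub_cancel] at h1 h2
    have c1 : (ν * p + D) / (D + 1) = q :=
      Nat.div_eq_of_lt_le (by nlinarith) (by nlinarith)
    have c2 : ((D + 1) * p + D) / (D + 1) = p :=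
      Nat.div_eq_of_lt_le (by nlinarith) (by nlinarith)
    have c3 : ((ν + 2) * p + D) / (D + 1) = q + 1 :=
      Nat.div_eq_of_lt_le (by nlinarith) (by nlinarith)
    rw [c1, c2] at h1
    rw [c3] at h2
    rw [Fintype.card_subtype, Finset.card_filter, Fintype.card_subtype, Finset.card_filter]
    have h3 : ∑ t : Token ν D, (if t.Crosses (D + 1) p then 1 else 0) =
        ∑ t : Token ν D, (match t with
          | none => 1 | some (_, j) => if CrossesMultiple (D + 1) p (j + 1) then 1 else 0) :=
      Finset.sum_congr rfl fun t _ => by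
        rcases t with _ | ⟨k, j⟩
        · exact if_pos trivial
        · exact if_congr Iff.rfl rfl rfl
    have h4 : ∑ x : {x : Fin (ν + 2) × Fin (D + 1) // IsSlot x},
        (if CrossesMultiple (D + 1) p x.1.2 then 1 else 0) =
        ∑ x : Fin (ν + 2) × Fin (D + 1),
          (if IsSlot x then if CrossesMultiple (D + 1) p x.2 then 1 else 0 else 0) :=
      (Finset.sum_subtype (Finset.univ.filter IsSlot) (p := IsSlot) (fun x => by simp)
        (fun x => if CrossesMultiple (D + 1) p x.2 then 1 else 0)).symm.trans
        (Finset.sum_filter _ _)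
    rw [h3, h4]
    nlinarith

end Machine

section MachineProperties

variable {ν D p q : ℕ}

lemma Token.exists_word (w : ℕ → Fin (ν + 2)) : ∃ (t : Token ν D) (z : ℕ → Fin (ν + 2)),
    w = cat t.word z := by
  have hrep : ∀ k, (∀ i < k, w i = 0) → pre k w = List.replicate k 0 := fun k hk =>
    List.eq_replicate_iff.2 ⟨length_pre _ _, fun b hb => by
      obtain ⟨i, rfl⟩ := (List.mem_ofFn' _ _).1 hb
      exact hk i i.2⟩
  by_cases h : ∃ k < D, w k ≠ 0
  · classical
    obtain ⟨hk, hw⟩ := Nat.find_spec h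
    obtain ⟨j, hj⟩ := Fin.exists_succ_eq.2 hw
    refine ⟨some (⟨Nat.find h, hk⟩, j), drop (Nat.find h + 1) w, ?_⟩
    have h0 : pre (Nat.find h) w = List.replicate (Nat.find h) 0 := hrep _ fun i hi => by
      by_contra hne
      exact Nat.find_min h hi ⟨by omega, hne⟩
    have h1 : pre 1 (drop (Nat.find h) w) = [j.succ] := by simp [pre, drop, hj]
    conv_lhs => rw [← cat_pre_drop (Nat.find h + 1) w, pre_add, h0, h1]
    rfl
  · push Not at h
    refine ⟨none, drop D w, ?_⟩
    conv_lhs => rw [← cat_pre_drop D w, hrep D h]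
    rfl

lemma Token.spec_of_eq_cat (t : Token ν D) {w z : ℕ → Fin (ν + 2)} (h : w = cat t.word z) :
    match t with
    | none => ∀ i < D, w i = 0
    | some (k, j) => (∀ i < k.1, w i = 0) ∧ w k = j.succ := by
  subst h
  rcases t with _ | ⟨k, j⟩
  · intro i hi
    simp [cat, Token.word, hi]
  · refine ⟨fun i hi => ?_, ?_⟩
    · have hi' : i < k.1 + 1 := by omega
      simp [cat, Token.word, hi', hi]
    · simp [cat, Token.word]

lemma Token.eq_of_cat_eq {t t' : Token ν D} {z z' : ℕ → Fin (ν + 2)}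
    (h : cat t.word z = cat t'.word z') : t = t' := by
  have h1 := t.spec_of_eq_cat rfl (z := z)
  have h2 := t'.spec_of_eq_cat h
  rcases t with _ | ⟨k, j⟩ <;> rcases t' with _ | ⟨k', j'⟩
  · rfl
  · exact absurd ((h1 _ k'.2).symm.trans h2.2).symm (Fin.succ_ne_zero _)
  · exact absurd ((h2 _ k.2).symm.trans h1.2).symm (Fin.succ_ne_zero _)
  · dsimp only at h1 h2
    rcases lt_trichotomy k.1 k'.1 with hk | hk | hk
    · exact absurd ((h2.1 _ hk).symm.trans h1.2).symm (Fin.succ_ne_zero _)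
    · obtain rfl := Fin.ext hk
      rw [Fin.succ_injective _ (h1.2.symm.trans h2.2)]
    · exact absurd ((h1.1 _ hk).symm.trans h2.2).symm (Fin.succ_ne_zero _)

lemma val_nextState_zero (c : Fin (D + 1)) :
    (nextState (0 : Fin (ν + 2)) c).1 = c - (ν + 1) := by simp [nextState]

lemma val_nextState_one (c : Fin (D + 1)) :
    (nextState (1 : Fin (ν + 2)) c).1 = min (c + (D - ν)) D := by simp [nextState]

lemma nextState_of_ne {i : Fin (ν + 2)} (h0 : i ≠ 0) (h1 : i ≠ 1) (c : Fin (D + 1)) :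
    nextState i c = Fin.last D := by simp [nextState, h0, h1]

lemma isSlot_iff {i : Fin (ν + 2)} {c : Fin (D + 1)} (hν : ν + 1 ≤ D) :
    IsSlot (i, c) ↔ nextState i c = Fin.last D := by
  have := c.2
  by_cases h0 : i = 0
  · subst h0
    simp [IsSlot, Fin.ext_iff, val_nextState_zero]; omega
  by_cases h1 : i = 1
  · subst h1
    simp [IsSlot, Fin.ext_iff, val_nextState_one]
    omega
  · simp [IsSlot, h0, h1, nextState_of_ne]

variable (e : {x : Fin (ν + 2) × Fin (D + 1) // IsSlot x} ≃ Token ν D)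

lemma output_of_isSlot {i : Fin (ν + 2)} {c : Fin (D + 1)} (h : IsSlot (i, c)) :
    output e i c = (e ⟨(i, c), h⟩).word := dif_pos h

lemma output_zero_of_lt {c : Fin (D + 1)} (h : c.1 < ν + 2) :
    output e 0 c = [⟨c, h⟩] := by
  simp [output, IsSlot, h]

lemma output_of_lt_last {i : Fin (ν + 2)} {c : Fin (D + 1)} (h : ¬ IsSlot (i, c))
    (h' : ¬ (c.1 < ν + 2 ∧ i = 0)) : output e i c = [] := by
  rw [output, dif_neg h, dif_neg h']

/-- Away from the first and the last state, nothing is written and the state is rotated. -/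
lemma nextState_eq_of_mid {i : Fin (ν + 2)} {c : Fin (D + 1)} (h : ¬ IsSlot (i, c))
    (h' : ¬ (c.1 < ν + 2 ∧ i = 0)) (hν : ν + 1 ≤ D) : (nextState i c).1 ≠ 0 ∧
      ((i = 0 ∧ c.1 = (nextState i c).1 + (ν + 1)) ∨
        i = 1 ∧ c.1 + (D + 1) = (nextState i c).1 + (ν + 1)) := by
  have := c.2
  rw [isSlot_iff hν, Fin.ext_iff, Fin.val_last] at h
  by_cases h0 : i = 0
  · subst h0
    rw [val_nextState_zero] at *
    simp at h' ⊢
    omega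
  by_cases h1 : i = 1
  · subst h1
    rw [val_nextState_one] at *
    simp
    omega
  · simp [nextState_of_ne h0 h1] at h

/-- The step function whose inverse is the transducer. -/
def inflate (x : Fin (ν + 2) × Ends (Fin (ν + 2)) (Fin (D + 1))) :
    Ends (Fin (ν + 2)) (Fin (D + 1)) :=
  (nextState x.1 x.2.1, cat (output e x.1 x.2.1) x.2.2)

lemma continuous_inflate : Continuous (inflate e) := by
  refine continuous_prod_of_discrete_left.2 fun i =>
    (continuous_prod_of_discrete_left (f := fun x : Ends _ _ => inflate e (i, x))).2 fun c => ?_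
  exact Continuous.prodMk (f := fun _ => nextState i c) continuous_const
    (continuous_cat (output e i c))

lemma injective_inflate (hν : ν + 1 ≤ D) : Injective (inflate e) := by
  rintro ⟨i, c, w⟩ ⟨i', c', w'⟩ h
  obtain ⟨h1, h2⟩ := Prod.ext_iff.1 h
  simp only [inflate] at h1 h2
  by_cases hs : IsSlot (i, c)
  · have hs' : IsSlot (i', c') := by rwa [isSlot_iff hν, ← h1, ← isSlot_iff hν]
    rw [output_of_isSlot e hs, output_of_isSlot e hs'] at h2
    have := Token.eq_of_cat_eq h2
    rw [← this] at h2
    obtain ⟨rfl, rfl⟩ := Prod.ext_iff.1 (congrArg Subtype.val (e.injective this))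
    rw [cat_injective _ h2]
  have hs' : ¬ IsSlot (i', c') := by rwa [isSlot_iff hν, ← h1, ← isSlot_iff hν]
  have hv := congrArg Fin.val h1
  by_cases hz : c.1 < ν + 2 ∧ i = 0 <;> by_cases hz' : c'.1 < ν + 2 ∧ i' = 0
  · obtain ⟨hc, rfl⟩ := hz
    obtain ⟨hc', rfl⟩ := hz'
    rw [output_zero_of_lt e hc, output_zero_of_lt e hc'] at h2
    have h3 := congrFun h2 0
    simp [cat] at h3
    obtain rfl := Fin.ext h3
    rw [cat_injective _ h2]
  · obtain ⟨hc, rfl⟩ := hz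
    have := (nextState_eq_of_mid hs' hz' hν).1
    rw [val_nextState_zero] at hv
    omega
  · obtain ⟨hc, rfl⟩ := hz'
    have := (nextState_eq_of_mid hs hz hν).1
    rw [val_nextState_zero] at hv
    omega
  · rw [output_of_lt_last e hs hz, output_of_lt_last e hs' hz', cat_nil, cat_nil] at h2
    have h3 := (nextState_eq_of_mid hs hz hν).2
    have h4 := (nextState_eq_of_mid hs' hz' hν).2
    have := c.2
    have := c'.2
    subst h2
    rcases h3 with ⟨rfl, h3⟩ | ⟨rfl, h3⟩ <;> rcases h4 with ⟨rfl, h4⟩ | ⟨rfl, h4⟩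
    · rw [Fin.ext (show c.1 = c'.1 by omega)]
    · omega
    · omega
    · rw [Fin.ext (show c.1 = c'.1 by omega)]

lemma exists_of_mid (hν : ν + 1 ≤ D) {a : Fin (D + 1)} (h0 : a ≠ 0) (hD : a ≠ Fin.last D) :
    ∃ (i : Fin (ν + 2)) (c : Fin (D + 1)), nextState i c = a ∧ output e i c = [] ∧
      (c.1 = a.1 + (ν + 1) ∨ c.1 + (D + 1) = a.1 + (ν + 1)) := by
  have h0' : a.1 ≠ 0 := fun h => h0 (Fin.ext h)
  have hD' : a.1 ≠ D := fun h => hD (Fin.ext h)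
  have := a.2
  by_cases h : a.1 + (ν + 1) < D + 1
  · have hn : nextState (0 : Fin (ν + 2)) ⟨a.1 + (ν + 1), h⟩ = a :=
      Fin.ext (by rw [val_nextState_zero]; simp)
    refine ⟨0, ⟨a.1 + (ν + 1), h⟩, hn, output_of_lt_last e ?_ ?_, Or.inl rfl⟩
    · rwa [isSlot_iff hν, hn]
    · simp; omega
  · have hn : nextState (1 : Fin (ν + 2)) ⟨a.1 + ν - D, by omega⟩ = a :=
      Fin.ext (by rw [val_nextState_one]; simp; omega)
    refine ⟨1, ⟨a.1 + ν - D, by omega⟩, hn, output_of_lt_last e ?_ ?_, Or.inr ?_⟩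
    · rwa [isSlot_iff hν, hn]
    · simp
    · dsimp only; omega

lemma surjective_inflate (hν : ν + 1 ≤ D) : Surjective (inflate e) := by
  rintro ⟨a, w⟩
  by_cases hD : a = Fin.last D
  · obtain ⟨t, z, rfl⟩ := Token.exists_word (D := D) w
    refine ⟨((e.symm t).1.1, (e.symm t).1.2, z), Prod.ext ?_ ?_⟩
    · exact ((isSlot_iff hν).1 (e.symm t).2).trans hD.symm
    · simp only [inflate]
      rw [output_of_isSlot e (e.symm t).2]
      simp
  by_cases h0 : a = 0
  · have hw := (w 0).2
    refine ⟨(0, ⟨w 0, by omega⟩, drop 1 w), Prod.ext (Fin.ext ?_) ?_⟩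
    · simp only [inflate, val_nextState_zero, h0, Fin.val_zero]
      omega
    · simp only [inflate]
      rw [output_zero_of_lt e hw]
      conv_rhs => rw [← cat_pre_drop 1 w]
      simp [pre]
  · obtain ⟨i, c, h1, h2, -⟩ := exists_of_mid e hν h0 hD
    exact ⟨(i, c, w), by simp [inflate, h1, h2]⟩

end MachineProperties

lemma exists_modEq_of_rotation {d ρ p : ℕ} (hp : p * ρ ≡ 1 [MOD d + 1]) {a : ℕ → ℕ}
    (ha : ∀ k, a (k + 1) ≡ a k + ρ [MOD d + 1]) (c : ℕ) : ∃ k, a k ≡ c [MOD d + 1] := by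
  have h : ∀ k, a k ≡ a 0 + k * ρ [MOD d + 1] := by
    intro k
    induction k with
    | zero => simpa using Nat.ModEq.refl _
    | succ k ih =>
      refine (ha k).trans ?_
      rw [Nat.succ_mul, ← Nat.add_assoc]
      exact ih.add_right ρ
  refine ⟨p * (c + d * a 0), (h _).trans ?_⟩
  have h1 : p * (c + d * a 0) * ρ ≡ 1 * (c + d * a 0) [MOD d + 1] := by
    rw [Nat.mul_right_comm]
    exact hp.mul_right _
  refine (h1.add_left (a 0)).trans ?_
  rw [show a 0 + 1 * (c + d * a 0) = c + (d + 1) * a 0 by ring]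
  simp [Nat.ModEq]

section MachineRuns

variable {ν D p q : ℕ}

variable (e : {x : Fin (ν + 2) × Fin (D + 1) // IsSlot x} ≃ Token ν D)

lemma exists_output_ne_nil (hν : ν + 1 ≤ D) (hp : p * (ν + 1) ≡ 1 [MOD D + 1])
    (i : ℕ → Fin (ν + 2)) (a : ℕ → Fin (D + 1)) (ha : ∀ k, a k = nextState (i k) (a (k + 1))) :
    ∃ k, output e (i k) (a (k + 1)) ≠ [] := by
  by_contra! h
  have key : ∀ k, (a k).1 ≠ 0 ∧ ((i k = 0 ∧ (a (k + 1)).1 = a k + (ν + 1)) ∨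
        i k = 1 ∧ (a (k + 1)).1 + (D + 1) = a k + (ν + 1)) := by
    intro k
    have hs : ¬ IsSlot (i k, a (k + 1)) := fun hs => by
      have := h k
      rw [output_of_isSlot e hs] at this
      rcases hx : e ⟨_, hs⟩ with _ | ⟨l, j⟩ <;> rw [hx] at this <;> simp [Token.word] at this
      omega
    have hz : ¬ ((a (k + 1)).1 < ν + 2 ∧ i k = 0) := fun ⟨h1, h2⟩ => by
      have := h k
      rw [h2, output_zero_of_lt e h1] at this
      simp at this
    rw [ha k]
    exact nextState_eq_of_mid hs hz hν
  obtain ⟨k, hk⟩ := exists_modEq_of_rotation (d := D) (a := fun k => (a k).1) hp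
    (fun k => by
      rcases (key k).2 with ⟨-, h⟩ | ⟨-, h⟩
      · exact h ▸ Nat.ModEq.refl _
      · exact h ▸ (Nat.add_modEq_right).symm) 0
  exact (key k).1 (hk.eq_of_lt_of_lt (a k).2 (by simp))

lemma state_unique (hν : ν + 1 ≤ D) (hp : p * (ν + 1) ≡ 1 [MOD D + 1])
    (i : ℕ → Fin (ν + 2)) (a b : ℕ → Fin (D + 1))
    (ha : ∀ k, a k = nextState (i k) (a (k + 1)))
    (hb : ∀ k, b k = nextState (i k) (b (k + 1))) : a 0 = b 0 := by
  wlog hlt : a 0 < b 0 generalizing a b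
  · by_contra hne
    exact hne (this b a hb ha (lt_of_le_of_ne (not_lt.1 hlt) (Ne.symm hne))).symm
  have step : ∀ k, (a k).1 < (b k).1 → (a (k + 1)).1 < (b (k + 1)).1 ∧
      (b k).1 - (a k).1 ≤ (b (k + 1)).1 - (a (k + 1)).1 ∧
      ((b k).1 - (a k).1 = (b (k + 1)).1 - (a (k + 1)).1 →
        (a (k + 1)).1 = a k + (ν + 1) ∨ (a (k + 1)).1 + (D + 1) = a k + (ν + 1)) := by
    intro k hk
    have h1 := congrArg Fin.val (ha k)
    have h2 := congrArg Fin.val (hb k)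
    have := (a (k + 1)).2
    have := (b (k + 1)).2
    by_cases h0 : i k = 0
    · rw [h0, val_nextState_zero] at h1 h2
      omega
    by_cases h0' : i k = 1
    · rw [h0', val_nextState_one] at h1 h2
      omega
    · rw [nextState_of_ne h0 h0'] at h1 h2
      omega
  have hab : ∀ k, (a k).1 < (b k).1 := by
    intro k
    induction k with
    | zero => exact hlt
    | succ k ih => exact (step k ih).1
  have hmono : Monotone fun k => (b k).1 - (a k).1 :=
    monotone_nat_of_le_succ fun k => (step k (hab k)).2.1
  obtain ⟨K, hK⟩ : ∃ K, ∀ k ≥ K, (b k).1 - (a k).1 = (b K).1 - (a K).1 := by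
    obtain ⟨m, ⟨K, rfl⟩, hm⟩ := Set.Finite.exists_maximal
      (s := Set.range fun k => (b k).1 - (a k).1)
      ((Set.finite_Iic D).subset (by rintro _ ⟨k, rfl⟩; have := (b k).2; simp; omega))
      (Set.range_nonempty _)
    exact ⟨K, fun k hk => le_antisymm (hm ⟨k, rfl⟩ (hmono hk)) (hmono hk)⟩
  obtain ⟨k, hk⟩ := exists_modEq_of_rotation (d := D) (a := fun k => (a (K + k)).1) hp
    (fun k => by
      rcases (step (K + k) (hab _)).2.2 ((hK _ (by omega)).trans (hK (K + k + 1) (by omega)).symm)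
        with h | h
      · exact h ▸ Nat.ModEq.refl _
      · exact h ▸ (Nat.add_modEq_right).symm) D
  have h1 := hk.eq_of_lt_of_lt (a (K + k)).2 (by simp)
  have h2 := hab (K + k)
  have h3 := (b (K + k)).2
  omega

open scoped Classical in
/-- The first state if `P`, and the last state otherwise. -/
noncomputable def endState (D : ℕ) (P : Prop) : Fin (D + 1) := if P then 0 else Fin.last D

lemma run_endState (hν : ν + 1 ≤ D) (hp : p ≤ D) (hpq : p * (ν + 1) = q * (D + 1) + 1)
    (a : Fin (D + 1)) :
    Run nextState (output e) a [] (endState D (CrossesMultiple (D + 1) p a)) := by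
  have hp0 : 0 < p := Nat.pos_of_ne_zero (by rintro rfl; simp at hpq)
  have hcop : Nat.Coprime (D + 1) p := by
    refine Nat.Coprime.symm (Nat.isCoprime_iff_coprime.1 ⟨ν + 1, -q, ?_⟩)
    have : (p * (ν + 1) : ℤ) = q * (D + 1) + 1 := by exact_mod_cast hpq
    push_cast
    linarith
  have key : ∀ t < D + 1, ∀ a : Fin (D + 1), D + 1 ∣ a * p + t →
      Run nextState (output e) a [] (endState D (t < p)) := by
    intro t
    induction t with
    | zero =>
      intro _ a h
      have : a = 0 := Fin.ext (Nat.eq_zero_of_dvd_of_lt (hcop.dvd_of_dvd_mul_right h) a.2)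
      rw [endState, if_pos hp0, this]
      exact Run.refl _
    | succ t ih =>
      intro ht a h
      by_cases h0 : a = 0
      · subst h0
        exact absurd (Nat.le_of_dvd (by simp) h) (by simp; omega)
      by_cases hD : a = Fin.last D
      · subst hD
        have h2 : D * p + p ≡ D * p + (t + 1) [MOD D + 1] :=
          Nat.ModEq.trans (b := 0) (by simp [Nat.ModEq, ← Nat.succ_mul])
            ((Nat.modEq_zero_iff_dvd.2 h).symm)
        have h3 : p = t + 1 :=
          (Nat.ModEq.add_left_cancel' _ h2).eq_of_lt_of_lt (by omega) ht
        rw [endState, if_neg (by omega)]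
        exact Run.refl _
      obtain ⟨i, c, h1, h2, h3⟩ := exists_of_mid e hν h0 hD
      have h4 := (ih (by omega) c ?_).step i (A := nextState) (V := output e)
      · rw [h1, h2] at h4
        have : t + 1 ≠ p := by
          rintro rfl
          rw [← Nat.succ_mul] at h
          exact hD (Fin.ext (by
            have := Nat.le_of_dvd (by omega) (hcop.dvd_of_dvd_mul_right h)
            have := a.2
            rw [Fin.val_last]; omega))
        rwa [show (t + 1 < p) = (t < p) from propext (by omega)]
      · rcases h3 with h3 | h3
        · rw [h3, show (a.1 + (ν + 1)) * p + t = (D + 1) * q + (a * p + (t + 1)) by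
            linear_combination hpq]
          exact (Nat.dvd_add_right (dvd_mul_right _ _)).2 h
        · refine (Nat.dvd_add_right (dvd_mul_right (D + 1) p)).1 ?_
          rw [show (D + 1) * p + (c * p + t) = (D + 1) * q + (a * p + (t + 1)) by
            linear_combination hpq + p * h3]
          exact (Nat.dvd_add_right (dvd_mul_right _ _)).2 h
  have hlt := Nat.mod_lt (a * p) (Nat.succ_pos D)
  set t := (D + 1 - a * p % (D + 1)) % (D + 1) with ht
  have htd : D + 1 ∣ a * p + t := by
    rw [← Nat.modEq_zero_iff_dvd, Nat.ModEq, ht, Nat.add_mod_mod, ← Nat.mod_add_mod,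
      Nat.add_sub_cancel' hlt.le]
    simp
  have := key t (Nat.mod_lt _ (Nat.succ_pos D)) a htd
  rwa [show (t < p) = CrossesMultiple (D + 1) p a from propext ⟨fun h => ⟨t, h, htd⟩, ?_⟩] at this
  rintro ⟨s, hs, hsd⟩
  have h1 : a * p + s ≡ a * p + t [MOD D + 1] :=
    (Nat.modEq_zero_iff_dvd.2 hsd).trans (Nat.modEq_zero_iff_dvd.2 htd).symm
  have h2 := (Nat.ModEq.add_left_cancel' _ h1).eq_of_lt_of_lt (by omega)
    (Nat.mod_lt _ (Nat.succ_pos D))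
  omega

end MachineRuns

lemma exists_eq_replicate_append {ν : ℕ} (m : ℕ) (v : List (Fin (ν + 2))) :
    (∃ r, v = List.replicate m 0 ++ r) ∨ (∃ k < m, v = List.replicate k 0) ∨
      ∃ k < m, ∃ (x : Fin (ν + 1)) (r : List (Fin (ν + 2))),
        v = List.replicate k 0 ++ x.succ :: r := by
  induction m generalizing v with
  | zero => exact Or.inl ⟨v, rfl⟩
  | succ m ih =>
    rcases v with _ | ⟨x, v⟩
    · exact Or.inr (Or.inl ⟨0, by omega, rfl⟩)
    by_cases hx : x = 0
    · subst hx
      rcases ih v with ⟨r, rfl⟩ | ⟨k, hk, rfl⟩ | ⟨k, hk, x, r, rfl⟩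
      · exact Or.inl ⟨r, rfl⟩
      · exact Or.inr (Or.inl ⟨k + 1, by omega, rfl⟩)
      · exact Or.inr (Or.inr ⟨k + 1, by omega, x, r, rfl⟩)
    · obtain ⟨j, rfl⟩ := Fin.exists_succ_eq.2 hx
      exact Or.inr (Or.inr ⟨0, by omega, j, v, rfl⟩)

section MachineSynchronization

variable {ν D p q : ℕ} {e : {x : Fin (ν + 2) × Fin (D + 1) // IsSlot x} ≃ Token ν D}

lemma run_zero (hν : ν + 1 ≤ D) (hp : p ≤ D) (hpq : p * (ν + 1) = q * (D + 1) + 1)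
    (j : Fin (ν + 2)) :
    Run nextState (output e) 0 [j] (endState D (CrossesMultiple (D + 1) p j)) := by
  have hj := j.2
  have h := (run_endState e hν hp hpq ⟨j, by omega⟩).step 0
  rw [output_zero_of_lt e hj] at h
  have hn : nextState (0 : Fin (ν + 2)) (⟨j, by omega⟩ : Fin (D + 1)) = 0 :=
    Fin.ext (by rw [val_nextState_zero, Fin.val_zero]; dsimp only; omega)
  rw [hn] at h
  exact h

lemma run_last (hν : ν + 1 ≤ D) (hp : p ≤ D) (hpq : p * (ν + 1) = q * (D + 1) + 1)
    (he : ∀ x, (e x).Crosses (D + 1) p ↔ CrossesMultiple (D + 1) p x.1.2) (t : Token ν D) :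
    Run nextState (output e) (Fin.last D) t.word (endState D (t.Crosses (D + 1) p)) := by
  obtain ⟨⟨⟨i, c⟩, hs⟩, rfl⟩ := e.surjective t
  have h := (run_endState e hν hp hpq c).step i
  rw [output_of_isSlot e hs, (isSlot_iff hν).1 hs, List.append_nil] at h
  rw [propext (he ⟨(i, c), hs⟩)]
  exact h

lemma endState_eq (D : ℕ) (P : Prop) : endState D P = 0 ∨ endState D P = Fin.last D := by
  unfold endState; split_ifs <;> simp

lemma run_append_succ (hν : ν + 1 ≤ D) (hp : p ≤ D) (hpq : p * (ν + 1) = q * (D + 1) + 1)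
    (he : ∀ x, (e x).Crosses (D + 1) p ↔ CrossesMultiple (D + 1) p x.1.2) (j : Fin (ν + 1)) :
    ∀ (v : List (Fin (ν + 2))) (a : Fin (D + 1)), Run nextState (output e) a (v ++ [j.succ])
      (endState D (CrossesMultiple (D + 1) p j.succ)) := by
  intro v
  induction hL : v.length using Nat.strong_induction_on generalizing v with
  | _ L ih =>
  intro a
  suffices h : ∀ a, a = 0 ∨ a = Fin.last D → Run nextState (output e) a (v ++ [j.succ])
      (endState D (CrossesMultiple (D + 1) p j.succ)) from
    (run_endState e hν hp hpq a).trans (h _ (endState_eq _ _))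
  rintro _ (rfl | rfl)
  · rcases v with _ | ⟨x, v⟩
    · exact run_zero hν hp hpq _
    · exact (run_zero hν hp hpq x).trans (ih _ (by rw [← hL]; simp) v rfl _)
  · rcases exists_eq_replicate_append D v with ⟨r, rfl⟩ | ⟨k, hk, rfl⟩ | ⟨k, hk, x, r, rfl⟩
    · rw [List.append_assoc]
      exact (run_last hν hp hpq he none).trans
        (ih _ (by rw [← hL]; simp; omega) r rfl _)
    · exact run_last hν hp hpq he (some (⟨k, hk⟩, j))
    · have h := (run_last hν hp hpq he (some (⟨k, hk⟩, x))).trans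
        (ih _ (by rw [← hL]; simp; omega) r rfl _)
      simpa only [Token.word, List.append_assoc, List.cons_append, List.nil_append] using h

lemma run_append_replicate (hν : ν + 1 ≤ D) (hp : p ≤ D)
    (hpq : p * (ν + 1) = q * (D + 1) + 1)
    (he : ∀ x, (e x).Crosses (D + 1) p ↔ CrossesMultiple (D + 1) p x.1.2) (a : Fin (D + 1))
    (v : List (Fin (ν + 2))) {L : ℕ} (hL : D ≤ L) :
    Run nextState (output e) a (v ++ List.replicate L 0) 0 := by
  have hp0 : 0 < p := Nat.pos_of_ne_zero (by rintro rfl; simp at hpq)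
  have h0 : ∀ k, Run nextState (output e) 0 (List.replicate k 0) 0 := by
    intro k
    induction k with
    | zero => exact Run.refl _
    | succ k ih =>
      have h := run_zero (e := e) hν hp hpq 0
      rw [endState, if_pos ⟨0, hp0, by simp⟩] at h
      exact h.trans ih
  have h1 : ∀ (a : Fin (D + 1)) (L : ℕ), D ≤ L →
      Run nextState (output e) a (List.replicate L 0) 0 := by
    intro a L hL
    refine (run_endState e hν hp hpq a).trans ?_
    rcases endState_eq D (CrossesMultiple (D + 1) p a) with h | h <;> rw [h]
    · exact h0 L
    · have h := run_last hν hp hpq he none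
      rw [endState, if_pos (show Token.Crosses (D + 1) p (none : Token ν D) from trivial)] at h
      rw [← Nat.add_sub_cancel' hL, List.replicate_add]
      exact h.trans (h0 _)
  induction v using List.reverseRecOn generalizing L with
  | nil => exact h1 a L hL
  | append_singleton v x ih =>
    by_cases hx : x = 0
    · subst hx
      rw [List.append_assoc]
      exact ih (L := L + 1) (by omega)
    · obtain ⟨j, rfl⟩ := Fin.exists_succ_eq.2 hx
      exact (run_append_succ hν hp hpq he j v a).trans (h1 _ L hL)

theorem tailEquivalent_fin_unit (hν : ν + 1 ≤ D) (hp : p ≤ D)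
    (hpq : p * (ν + 1) = q * (D + 1) + 1) :
    TailEquivalent (Fin (ν + 2)) (Fin (D + 1)) Unit := by
  obtain ⟨e, he⟩ := exists_slot_equiv hν hp hpq
  have hmod : p * (ν + 1) ≡ 1 [MOD D + 1] := by
    rw [hpq, Nat.ModEq, Nat.mul_add_mod']
  let Φ : Fin (ν + 2) × Ends (Fin (ν + 2)) (Fin (D + 1)) ≃ₜ Ends (Fin (ν + 2)) (Fin (D + 1)) :=
    Continuous.homeoOfEquivCompactToT2
      (f := Equiv.ofBijective (inflate e) ⟨injective_inflate e hν, surjective_inflate e hν⟩)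
      (continuous_inflate e)
  refine tailEquivalent_of_transducer (Φ := Φ) (A := nextState) (V := output e)
    (fun _ _ => rfl) (state_unique hν hmod) (exists_output_ne_nil e hν hmod) ?_
  intro a u a' u' w
  by_cases h : ∃ l, w l ≠ 0
  · obtain ⟨l, hl⟩ := h
    obtain ⟨j, hj⟩ := Fin.exists_succ_eq.2 hl
    have hw : pre (l + 1) w = pre l w ++ [j.succ] := by
      rw [pre_add]; simp [pre, drop, hj]
    refine ⟨l + 1, endState D (CrossesMultiple (D + 1) p j.succ), ?_⟩
    rw [hw, ← List.append_assoc, ← List.append_assoc]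
    exact ⟨run_append_succ hν hp hpq he j _ _, run_append_succ hν hp hpq he j _ _⟩
  · push Not at h
    have hw : pre D w = List.replicate D 0 := by
      simp [pre, h, List.ofFn_const]
    refine ⟨D, 0, ?_⟩
    rw [hw]
    exact ⟨run_append_replicate hν hp hpq he a u le_rfl,
      run_append_replicate hν hp hpq he a' u' le_rfl⟩

end MachineSynchronization

lemma tailEquivalent_fin_add (ν a k : ℕ) (ha : 1 ≤ a) :
    TailEquivalent (Fin (ν + 2)) (Fin a) (Fin (a + k * (ν + 1))) := by
  induction k with
  | zero => exact .of_equiv (finCongr (by simp))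
  | succ k ih =>
    refine ih.trans ?_
    obtain ⟨b, hb⟩ : ∃ b, a + k * (ν + 1) = b + 1 := ⟨a + k * (ν + 1) - 1, by omega⟩
    refine (TailEquivalent.of_equiv ((finCongr hb).trans
      ((finSumFinEquiv (m := b) (n := 1)).symm.trans
        ((Equiv.refl _).sumCongr (Equiv.equivPUnit (Fin 1)))))).trans
      ((tailEquivalent_expand (α := Fin (ν + 2)) (ι := Fin b)).symm.trans
        (.of_equiv (finSumFinEquiv.trans (finCongr ?_))))
    rw [Nat.succ_mul]; omega

lemma tailEquivalent_fin_of_modEq {ν a b : ℕ} (ha : 1 ≤ a) (hb : 1 ≤ b)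
    (h : a ≡ b [MOD ν + 1]) : TailEquivalent (Fin (ν + 2)) (Fin a) (Fin b) := by
  wlog hab : a ≤ b generalizing a b
  · exact (this hb ha h.symm (by omega)).symm
  obtain ⟨k, hk⟩ := (Nat.modEq_iff_dvd' hab).1 h
  have hb' : a + k * (ν + 1) = b := by rw [mul_comm, ← hk]; omega
  exact hb' ▸ tailEquivalent_fin_add ν a k ha

lemma exists_unit_mul_gcd {m : ℕ} (hm : 0 < m) (r : ℕ) :
    ∃ u : (ZMod m)ˣ, (r : ZMod m) = u * (Nat.gcd m r : ℕ) := by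
  have : NeZero m := ⟨hm.ne'⟩
  obtain ⟨d, hd, _, ⟨u, rfl⟩, h⟩ := ZMod.eq_unit_mul_divisor (r : ZMod m)
  have hmod : r ≡ (u : ZMod m).val * d [MOD m] := by
    rw [← ZMod.natCast_eq_natCast_iff]
    simpa using h
  refine ⟨u, ?_⟩
  rwa [Nat.gcd_comm, hmod.gcd_eq, Nat.Coprime.gcd_mul_left_cancel _ (ZMod.val_coe_unit_coprime u),
    Nat.gcd_eq_left hd]

lemma exists_coprime_mul_modEq {m r s : ℕ} (hm : 0 < m) (h : Nat.gcd m r = Nat.gcd m s) (N : ℕ) :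
    ∃ d, N ≤ d ∧ Nat.Coprime d m ∧ r * d ≡ s [MOD m] := by
  have : NeZero m := ⟨hm.ne'⟩
  obtain ⟨u, hu⟩ : ∃ u : (ZMod m)ˣ, (r : ZMod m) * u = s := by
    obtain ⟨u, hu⟩ := exists_unit_mul_gcd hm r
    obtain ⟨v, hv⟩ := exists_unit_mul_gcd hm s
    refine ⟨u⁻¹ * v, ?_⟩
    rw [hu, hv, h, Units.val_mul]
    linear_combination (v * (Nat.gcd m s : ℕ) : ZMod m) * u.mul_inv
  refine ⟨(u : ZMod m).val + N * m, by nlinarith, ?_, ?_⟩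
  · rw [Nat.coprime_add_mul_right_left]; exact ZMod.val_coe_unit_coprime u
  · rw [← ZMod.natCast_eq_natCast_iff]
    simpa using hu

lemma tailEquivalent_fin_of_gcd_eq {ν r s : ℕ} (hr : 1 ≤ r) (hs : 1 ≤ s)
    (h : Nat.gcd (ν + 1) r = Nat.gcd (ν + 1) s) :
    TailEquivalent (Fin (ν + 2)) (Fin r) (Fin s) := by
  obtain ⟨d, hd, hc, hmod⟩ := exists_coprime_mul_modEq (Nat.succ_pos ν) h (ν + 2)
  obtain ⟨D, rfl⟩ : ∃ D, d = D + 1 := ⟨d - 1, by omega⟩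
  obtain ⟨p, hpd, hp⟩ := Nat.exists_mul_mod_eq_one_of_coprime hc.symm (by omega)
  have hpq : p * (ν + 1) = (ν + 1) * p / (D + 1) * (D + 1) + 1 := by
    have := Nat.div_add_mod' ((ν + 1) * p) (D + 1)
    rw [hp] at this
    rw [this, mul_comm]
  have hcol := tailEquivalent_fin_unit (ν := ν) (by omega) (by omega) hpq
  exact (((tailEquivalent_fin_of_modEq (Nat.mul_pos hr (by omega)) hs hmod).symm.trans
    (.of_equiv finProdFinEquiv.symm)).trans ((hcol.prod (Fin r)).trans
      (.of_equiv (Equiv.prodPUnit _)))).symm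

end HigmanThompson

/-- If `gcd (n-1) r = gcd (n-1) s`, then the Higman–Thompson groups `G_{n,r}` and `G_{n,s}`
are isomorphic as groups. The group structures are specified via the (unique) Higman–Thompson
multiplication: the product of two maximal cofinite isomorphisms extends their composite. -/
theorem higmanThompson_iso_of_gcd_eq (n r s : ℕ) (hn : 2 ≤ n) (hr : 1 ≤ r) (hs : 1 ≤ s)
    (hgcd : Nat.gcd (n - 1) r = Nat.gcd (n - 1) s)
    [Group (HT n r)] [Group (HT n s)]
    (hmulr : IsHTMul n r (· * ·)) (hmuls : IsHTMul n s (· * ·)) :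
    Nonempty (HT n r ≃* HT n s) := by
  obtain ⟨ν, rfl⟩ : ∃ ν, n = ν + 2 := ⟨n - 2, by omega⟩
  have : NeZero r := ⟨by omega⟩
  have : NeZero s := ⟨by omega⟩
  obtain ⟨f⟩ := HigmanThompson.nonempty_prefixGroup_mulEquiv hmulr
  obtain ⟨g⟩ := HigmanThompson.nonempty_prefixGroup_mulEquiv hmuls
  obtain ⟨h⟩ := (HigmanThompson.tailEquivalent_fin_of_gcd_eq hr hs hgcd).nonempty_mulEquiv
  exact ⟨(f.symm.trans h).trans g⟩
end

section
/- Let K be a field, n ≥ 2 an integer, and r, s ≥ 1 integers. Then L_n^r and L_n^s are isomorphic as left L_n-modules if and only if r ≡ s (mod n−1). -/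
open scoped BigOperators

/-- Defining relations of the Leavitt algebra `L_K(1,n)`. -/
inductive LeavittRel (K : Type) [Field K] (n : ℕ) :
    FreeAlgebra K (Fin n ⊕ Fin n) → FreeAlgebra K (Fin n ⊕ Fin n) → Prop
  | xy (i j : Fin n) :
      LeavittRel K n (FreeAlgebra.ι K (Sum.inl i) * FreeAlgebra.ι K (Sum.inr j))
        (if i = j then 1 else 0)
  | yx :
      LeavittRel K n (∑ j : Fin n, FreeAlgebra.ι K (Sum.inr j) * FreeAlgebra.ι K (Sum.inl j)) 1

/-- The Leavitt algebra `L_n = L_K(1,n)`. -/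
abbrev Leavitt (K : Type) [Field K] (n : ℕ) := RingQuot (LeavittRel K n)

/-- The generator `x_i` of the Leavitt algebra. -/
noncomputable def lx (K : Type) [Field K] (n : ℕ) (i : Fin n) : Leavitt K n :=
  RingQuot.mkAlgHom K (LeavittRel K n) (FreeAlgebra.ι K (Sum.inl i))

/-- The generator `y_i` of the Leavitt algebra. -/
noncomputable def ly (K : Type) [Field K] (n : ℕ) (i : Fin n) : Leavitt K n :=
  RingQuot.mkAlgHom K (LeavittRel K n) (FreeAlgebra.ι K (Sum.inr i))

/-- `x_I = x_{i_k} ⋯ x_{i_1}` for a word `I = (i_1, …, i_k)`. -/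
noncomputable def xW (K : Type) [Field K] (n : ℕ) (I : List (Fin n)) : Leavitt K n :=
  (I.reverse.map (lx K n)).prod

/-- `y_I = y_{i_1} ⋯ y_{i_k}` for a word `I = (i_1, …, i_k)`. -/
noncomputable def yW (K : Type) [Field K] (n : ℕ) (I : List (Fin n)) : Leavitt K n :=
  (I.map (ly K n)).prod

/-- Auxiliary anti-homomorphism used to construct the involution on `L_n`. -/
noncomputable def leavittStarAux (K : Type) [Field K] (n : ℕ) :
    FreeAlgebra K (Fin n ⊕ Fin n) →ₐ[K] (Leavitt K n)ᵐᵒᵖ :=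
  FreeAlgebra.lift K fun s =>
    MulOpposite.op (RingQuot.mkAlgHom K (LeavittRel K n) (FreeAlgebra.ι K s.swap))

theorem leavittStarAux_rel (K : Type) [Field K] (n : ℕ) :
    ∀ ⦃a b : FreeAlgebra K (Fin n ⊕ Fin n)⦄, LeavittRel K n a b →
      leavittStarAux K n a = leavittStarAux K n b := by
  intro a b h
  induction h with
  | xy i j =>
    have h1 : (RingQuot.mkAlgHom K (LeavittRel K n))
        (FreeAlgebra.ι K (Sum.inl j) * FreeAlgebra.ι K (Sum.inr i)) =
        (RingQuot.mkAlgHom K (LeavittRel K n)) (if j = i then 1 else 0) :=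
      RingQuot.mkAlgHom_rel K (LeavittRel.xy j i)
    simp only [leavittStarAux, map_mul, FreeAlgebra.lift_ι_apply, Sum.swap_inl, Sum.swap_inr]
    rw [← MulOpposite.op_mul, ← map_mul, h1]
    by_cases hij : i = j
    · subst hij; simp
    · simp [hij, Ne.symm hij]
  | yx =>
    have h1 : (RingQuot.mkAlgHom K (LeavittRel K n))
        (∑ j : Fin n, FreeAlgebra.ι K (Sum.inr j) * FreeAlgebra.ι K (Sum.inl j)) =
        (RingQuot.mkAlgHom K (LeavittRel K n)) 1 :=
      RingQuot.mkAlgHom_rel K LeavittRel.yx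
    simp only [leavittStarAux, map_sum, map_mul, FreeAlgebra.lift_ι_apply, Sum.swap_inl,
      Sum.swap_inr, map_one]
    have key : ∀ x : Fin n,
        MulOpposite.op ((RingQuot.mkAlgHom K (LeavittRel K n)) (FreeAlgebra.ι K (Sum.inl x))) *
          MulOpposite.op ((RingQuot.mkAlgHom K (LeavittRel K n)) (FreeAlgebra.ι K (Sum.inr x))) =
        MulOpposite.opAddEquiv ((RingQuot.mkAlgHom K (LeavittRel K n))
          (FreeAlgebra.ι K (Sum.inr x) * FreeAlgebra.ι K (Sum.inl x))) := by
      intro x; rw [map_mul]; rfl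
    rw [Finset.sum_congr rfl fun x _ => key x, ← map_sum, ← map_sum, h1, map_one]
    rfl

/-- The involution `*` on the Leavitt algebra, as an algebra map into the opposite algebra. -/
noncomputable def lstarHom (K : Type) [Field K] (n : ℕ) :
    Leavitt K n →ₐ[K] (Leavitt K n)ᵐᵒᵖ :=
  RingQuot.liftAlgHom K ⟨leavittStarAux K n, leavittStarAux_rel K n⟩

/-- The involution `*` on the Leavitt algebra: the unique `K`-linear ring anti-automorphism
with `x_i* = y_i` and `y_i* = x_i`. -/
noncomputable def lstar (K : Type) [Field K] (n : ℕ) (a : Leavitt K n) : Leavitt K n :=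
  (lstarHom K n a).unop

/-- An element of `L_n` which is a finite (possibly empty) sum of monomials `y_I x_J`. -/
def IsSumYX (K : Type) [Field K] (n : ℕ) (a : Leavitt K n) : Prop :=
  ∃ (m : ℕ) (I J : Fin m → List (Fin n)), a = ∑ i, yW K n (I i) * xW K n (J i)

/-- The induced involution on matrices over `L_n`: `(A*)_{ij} = (A_{ji})*`. -/
noncomputable def mstar (K : Type) [Field K] (n r : ℕ)
    (A : Matrix (Fin r) (Fin r) (Leavitt K n)) : Matrix (Fin r) (Fin r) (Leavitt K n) :=
  fun i j => lstar K n (A j i)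

/-- The set `P_{n,r}` of unitary matrices over `L_n` all of whose entries are finite sums of
monomials `y_I x_J`. -/
def PsetM (K : Type) [Field K] (n r : ℕ) : Set (Matrix (Fin r) (Fin r) (Leavitt K n)) :=
  {A | (A * mstar K n r A = 1 ∧ mstar K n r A * A = 1) ∧ ∀ i j, IsSumYX K n (A i j)}

/-- `B` is a complete prefix code: a finite nonempty set of pairwise incomparable words such
that every word is comparable with some element of `B`. -/
def IsCPC (n : ℕ) (B : Set (List (Fin n))) : Prop :=
  B.Finite ∧ B.Nonempty ∧ (∀ u ∈ B, ∀ v ∈ B, u ≠ v → ¬ u <+: v) ∧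
    (∀ w : List (Fin n), ∃ u ∈ B, u <+: w ∨ w <+: u)
open Module
open scoped LinearMap.FiniteRangeSetoid

namespace LinearMap

section Index

variable {k : Type*} [Field k] {M N : Type*} [AddCommGroup M] [Module k M]
  [AddCommGroup N] [Module k N]

lemma IsQuasiInverse.finiteDimensional_ker {g : N →ₗ[k] M} {f : M →ₗ[k] N}
    (h : g.IsQuasiInverse f) : FiniteDimensional k f.ker := by
  have h₁ := (FiniteRangeSetoid.equiv_iff_hasFiniteRange.mp h.1.equiv).fg_range
  have : FiniteDimensional k (g ∘ₗ f - id).range := .of_fg h₁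
  have h₂ : f.ker ≤ (g ∘ₗ f - id).range := fun v hv => ⟨-v, by simp [mem_ker.mp hv]⟩
  exact Submodule.finiteDimensional_of_le h₂

lemma IsQuasiInverse.finiteDimensional_coker {g : N →ₗ[k] M} {f : M →ₗ[k] N}
    (h : g.IsQuasiInverse f) : FiniteDimensional k (N ⧸ f.range) := by
  refine Submodule.CoFG.of_le (S := eqLocus (f ∘ₗ g) id) (fun v hv => ⟨g v, hv⟩) ?_
  exact FiniteRangeSetoid.equiv_iff_eqLocus_coFG.mp h.2.equiv

/-- Quasi-invertible maps that agree up to finite range have the same index. -/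
lemma index_eq_of_equiv {f g : M →ₗ[k] N} (h : f ≈ g)
    [FiniteDimensional k f.ker] [FiniteDimensional k (N ⧸ f.range)]
    [FiniteDimensional k g.ker] [FiniteDimensional k (N ⧸ g.range)] :
    f.index = g.index := by
  let A := eqLocus f g
  have hA : FiniteDimensional k (M ⧸ A) := FiniteRangeSetoid.equiv_iff_eqLocus_coFG.mp h
  have hr : FiniteDimensional k (M ⧸ A.subtype.range) := by rwa [A.range_subtype]
  have hk : FiniteDimensional k A.subtype.ker := by
    rw [A.ker_subtype]; infer_instance
  have hfg : f ∘ₗ A.subtype = g ∘ₗ A.subtype := LinearMap.ext fun v => v.2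
  have h₁ := index_comp (f := A.subtype) f
  have h₂ := index_comp (f := A.subtype) g
  rw [hfg] at h₁
  linarith

variable (f : M →ₗ[k] N) (ι : Type*)

/-- The kernel of `f.compLeft ι` is a power of the kernel of `f`. -/
def kerCompLeftEquiv : (f.compLeft ι).ker ≃ₗ[k] (ι → f.ker) where
  toFun v i := ⟨v.1 i, congrFun (mem_ker.mp v.2) i⟩
  invFun w := ⟨fun i => w i, mem_ker.mpr (funext fun i => (w i).2)⟩
  map_add' _ _ := rfl
  map_smul' _ _ := rfl

lemma range_compLeft_eq_pi :
    (f.compLeft ι).range = Submodule.pi Set.univ fun _ : ι => f.range := by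
  ext v
  simp only [mem_range, Submodule.mem_pi, Set.mem_univ, true_implies]
  refine ⟨fun ⟨w, hw⟩ i => ⟨w i, congrFun hw i⟩, fun h => ?_⟩
  choose w hw using h
  exact ⟨w, funext hw⟩

/-- The cokernel of `f.compLeft ι` is a power of the cokernel of `f`. -/
noncomputable def cokerCompLeftEquiv [Fintype ι] [DecidableEq ι] :
    ((ι → N) ⧸ (f.compLeft ι).range) ≃ₗ[k] (ι → N ⧸ f.range) :=
  (Submodule.quotEquivOfEq _ _ (f.range_compLeft_eq_pi ι)).trans
    (Submodule.quotientPi fun _ : ι => f.range)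

lemma index_compLeft [Fintype ι] [FiniteDimensional k f.ker] [FiniteDimensional k (N ⧸ f.range)] :
    (f.compLeft ι).index = Fintype.card ι * f.index := by
  classical
  rw [index_eq_finrank_sub, index_eq_finrank_sub, (f.kerCompLeftEquiv ι).finrank_eq,
    (f.cokerCompLeftEquiv ι).finrank_eq, finrank_pi_fintype, finrank_pi_fintype]
  simp [mul_sub]

end Index

section MatrixOp

variable {k : Type*} [Field k] {V : Type*} [AddCommGroup V] [Module k V]
  {l m p : Type*} [Fintype m]

/-- The linear map `V^m → V^l` given by an `l × m` matrix of endomorphisms of `V`. -/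
def ofEndMatrix (A : Matrix l m (End k V)) : (m → V) →ₗ[k] (l → V) :=
  pi fun i => ∑ j, A i j ∘ₗ proj j

@[simp]
lemma ofEndMatrix_apply (A : Matrix l m (End k V)) (v : m → V) (i : l) :
    ofEndMatrix A v i = ∑ j, A i j (v j) := by
  simp [ofEndMatrix]

lemma ofEndMatrix_mul [Fintype p] (A : Matrix l m (End k V)) (B : Matrix m p (End k V)) :
    ofEndMatrix (A * B) = ofEndMatrix A ∘ₗ ofEndMatrix B := by
  refine LinearMap.ext fun v => funext fun i => ?_
  simp only [ofEndMatrix_apply, Matrix.mul_apply, comp_apply, map_sum, sum_apply, End.mul_apply]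
  exact Finset.sum_comm

lemma ofEndMatrix_one [DecidableEq m] : ofEndMatrix (1 : Matrix m m (End k V)) = id := by
  refine LinearMap.ext fun v => funext fun i => ?_
  simp only [ofEndMatrix_apply, Matrix.one_apply, id_apply]
  rw [Finset.sum_eq_single i (fun j _ hj => by simp [hj.symm]) (by simp)]
  simp

lemma ofEndMatrix_sub (A B : Matrix l m (End k V)) :
    ofEndMatrix (A - B) = ofEndMatrix A - ofEndMatrix B := by
  refine LinearMap.ext fun v => funext fun i => ?_
  simp

lemma hasFiniteRange_pi [Finite l] {W : Type*} [AddCommGroup W] [Module k W] {f : l → W →ₗ[k] V}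
    (h : ∀ i, (f i).HasFiniteRange) : (pi f).HasFiniteRange := by
  rw [← ker_coFG_iff_hasFiniteRange, ker_pi]
  exact Submodule.CoFG.sInf_of_finite (Set.finite_range _)
    (Set.forall_mem_range.mpr fun i => (h i).cofg_ker)

lemma hasFiniteRange_sum [Fintype l] {W : Type*} [AddCommGroup W] [Module k W] {f : l → W →ₗ[k] V}
    (h : ∀ i, (f i).HasFiniteRange) : (∑ i, f i).HasFiniteRange := by
  rw [← mem_finiteRange_iff_hasFiniteRange]
  exact Submodule.sum_mem _ fun i _ => mem_finiteRange_iff_hasFiniteRange.mpr (h i)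

lemma hasFiniteRange_ofEndMatrix [Finite l] {A : Matrix l m (End k V)}
    (h : ∀ i j, (A i j).HasFiniteRange) : (ofEndMatrix A).HasFiniteRange :=
  hasFiniteRange_pi fun i => hasFiniteRange_sum fun j => (h i j).comp_right _

end MatrixOp

section Calkin

variable (k : Type*) [Field k] (V : Type*) [AddCommGroup V] [Module k V]

/-- The ideal of finite range endomorphisms. -/
def finiteRangeIdeal : Ideal (End k V) where
  carrier := {f | f.HasFiniteRange}
  add_mem' hf hg := hf.add hg
  zero_mem' := .zero
  smul_mem' c _ hf := hf.comp_left c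

instance : (finiteRangeIdeal k V).IsTwoSided :=
  ⟨fun b h => HasFiniteRange.comp_right h b⟩

variable {k V}

lemma mk_eq_mk_iff_hasFiniteRange {f g : End k V} :
    Ideal.Quotient.mk (finiteRangeIdeal k V) f = Ideal.Quotient.mk (finiteRangeIdeal k V) g ↔
      (f - g).HasFiniteRange :=
  Ideal.Quotient.eq

lemma ofEndMatrix_equiv {l m : Type*} [Finite l] [Fintype m] {A B : Matrix l m (End k V)}
    (h : A.map (Ideal.Quotient.mk (finiteRangeIdeal k V)) =
      B.map (Ideal.Quotient.mk (finiteRangeIdeal k V))) :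
    ofEndMatrix A ≈ ofEndMatrix B := by
  rw [FiniteRangeSetoid.equiv_iff_hasFiniteRange, ← ofEndMatrix_sub]
  exact hasFiniteRange_ofEndMatrix fun i j =>
    mk_eq_mk_iff_hasFiniteRange.mp (congrFun (congrFun h i) j)

end Calkin

end LinearMap

namespace Leavitt

open LinearMap

section Fock

variable (K : Type) [Field K] (n : ℕ)

/-- The operator deleting a prepended letter, on functions on words. -/
def popFront (i : Fin n) : End K (List (Fin n) → K) := LinearMap.funLeft K K (List.cons i)

/-- The operator deleting an appended letter, on functions on words. -/
def popBack (i : Fin n) : End K (List (Fin n) → K) := LinearMap.funLeft K K (· ++ [i])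

/-- The operator prepending a letter, on functions on words. -/
def pushFront (i : Fin n) : End K (List (Fin n) → K) where
  toFun f
    | [] => 0
    | j :: w => if i = j then f w else 0
  map_add' f g := by ext (_ | ⟨j, w⟩) <;> simp [ite_add_ite]
  map_smul' c f := by ext (_ | ⟨j, w⟩) <;> simp

variable {K n}

@[simp]
lemma popFront_apply (i : Fin n) (f : List (Fin n) → K) (w : List (Fin n)) :
    popFront K n i f w = f (i :: w) := rfl

@[simp]
lemma popBack_apply (i : Fin n) (f : List (Fin n) → K) (w : List (Fin n)) :
    popBack K n i f w = f (w ++ [i]) := rfl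

@[simp]
lemma pushFront_nil (i : Fin n) (f : List (Fin n) → K) : pushFront K n i f [] = 0 := rfl

@[simp]
lemma pushFront_cons (i j : Fin n) (f : List (Fin n) → K) (w : List (Fin n)) :
    pushFront K n i f (j :: w) = if i = j then f w else 0 := rfl

lemma hasFiniteRange_of_supported_nil {T : End K (List (Fin n) → K)}
    (h : ∀ f i w, T f (i :: w) = 0) : T.HasFiniteRange := by
  have hT : T = LinearMap.single K (fun _ => K) [] ∘ₗ LinearMap.proj [] ∘ₗ T := by
    ext1 f
    ext (_ | ⟨i, w⟩) <;> simp [h]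
  rw [hT]
  exact (HasFiniteRange.of_isNoetherian_rng (f := LinearMap.proj [] ∘ₗ T)).comp_left _

variable (K n)

/-- The action of the free algebra on functions on words. -/
noncomputable def fockHom : FreeAlgebra K (Fin n ⊕ Fin n) →ₐ[K] End K (List (Fin n) → K) :=
  FreeAlgebra.lift K (Sum.elim (popFront K n) (pushFront K n))

/-- The Leavitt algebra acts on functions on words modulo finite range operators. -/
noncomputable def calkinHom :
    Leavitt K n →+* End K (List (Fin n) → K) ⧸ finiteRangeIdeal K (List (Fin n) → K) :=
  RingQuot.lift ⟨(Ideal.Quotient.mk _).comp (fockHom K n).toRingHom, by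
    intro a b h
    simp only [RingHom.comp_apply]
    rw [mk_eq_mk_iff_hasFiniteRange]
    apply hasFiniteRange_of_supported_nil
    intro f l w
    induction h with
    | xy i j =>
      rcases eq_or_ne i j with rfl | hij
      · simp [fockHom]
      · simp [fockHom, hij, hij.symm]
    | yx => simp [fockHom, LinearMap.sum_apply]⟩

lemma calkinHom_mkAlgHom (a : FreeAlgebra K (Fin n ⊕ Fin n)) :
    calkinHom K n (RingQuot.mkAlgHom K (LeavittRel K n) a) =
      Ideal.Quotient.mk _ (fockHom K n a) := by
  rw [← RingHom.coe_coe (RingQuot.mkAlgHom K (LeavittRel K n)), RingQuot.mkAlgHom_coe]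
  exact RingQuot.lift_mkRingHom_apply _ _ _

lemma commute_calkinHom_popBack (a : Leavitt K n) (i : Fin n) :
    Commute (calkinHom K n a) (Ideal.Quotient.mk _ (popBack K n i)) := by
  obtain ⟨a, rfl⟩ := RingQuot.mkAlgHom_surjective K (LeavittRel K n) a
  rw [calkinHom_mkAlgHom]
  induction a using FreeAlgebra.induction with
  | grade0 c =>
    rw [AlgHom.commutes]
    exact Commute.map (Algebra.commutes c (popBack K n i)) (Ideal.Quotient.mk _)
  | grade1 s =>
    rw [Commute, SemiconjBy, ← map_mul, ← map_mul, mk_eq_mk_iff_hasFiniteRange]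
    apply hasFiniteRange_of_supported_nil
    intro f l w
    rcases s with j | j <;> simp [fockHom]
  | mul a b ha hb => rw [map_mul, map_mul]; exact ha.mul_left hb
  | add a b ha hb => rw [map_add, map_add]; exact ha.add_left hb

/-- The map splitting tuples of functions on words according to the last letter. -/
def splitLast (m : ℕ) :
    (Fin m → List (Fin n) → K) →ₗ[K] (Fin n → Fin m → List (Fin n) → K) :=
  LinearMap.pi fun i => (popBack K n i).compLeft (Fin m)

lemma splitLast_apply (m : ℕ) (v : Fin m → List (Fin n) → K) (i : Fin n) (j : Fin m)
    (w : List (Fin n)) : splitLast K n m v i j w = v j (w ++ [i]) := rfl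

lemma splitLast_surjective (m : ℕ) : Function.Surjective (splitLast K n m) := fun u =>
  ⟨fun j w => if h : w = [] then 0 else u (w.getLast h) j w.dropLast, by
    ext i j w
    simp [splitLast_apply]⟩

/-- The kernel of `splitLast` consists of the tuples of functions supported at the empty word. -/
def kerSplitLastEquiv (m : ℕ) : (splitLast K n m).ker ≃ₗ[K] (Fin m → K) where
  toFun v j := v.1 j []
  invFun c := ⟨fun j w => if w = [] then c j else 0, by
    rw [mem_ker]
    ext i j w
    simp [splitLast_apply]⟩
  map_add' _ _ := rfl
  map_smul' _ _ := rfl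
  left_inv v := by
    ext j w
    rcases w.eq_nil_or_concat with rfl | ⟨w, i, rfl⟩
    · simp
    · have h := congrFun (congrFun (congrFun (mem_ker.mp v.2) i) j) w
      rw [splitLast_apply] at h
      simpa using h.symm
  right_inv c := by simp

lemma index_splitLast (m : ℕ) : (splitLast K n m).index = m := by
  rw [index_of_surjective (splitLast_surjective K n m), (kerSplitLastEquiv K n m).finrank_eq]
  simp

end Fock

section Invariant

variable {K : Type} [Field K] {n : ℕ}

lemma splitLast_comp_ofEndMatrix_equiv {r s : ℕ}
    {A : Matrix (Fin r) (Fin s) (End K (List (Fin n) → K))}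
    (hA : ∀ i j l, Commute (Ideal.Quotient.mk (finiteRangeIdeal K _) (A i j))
      (Ideal.Quotient.mk _ (popBack K n l))) :
    splitLast K n r ∘ₗ ofEndMatrix A ≈
      (ofEndMatrix A).compLeft (Fin n) ∘ₗ splitLast K n s := by
  rw [FiniteRangeSetoid.equiv_iff_hasFiniteRange]
  have h : splitLast K n r ∘ₗ ofEndMatrix A -
      (ofEndMatrix A).compLeft (Fin n) ∘ₗ splitLast K n s =
      LinearMap.pi fun l => ofEndMatrix <|
        Matrix.of fun i j => popBack K n l * A i j - A i j * popBack K n l := by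
    refine LinearMap.ext fun v => funext fun l => funext fun i => ?_
    simp [splitLast]
  rw [h]
  refine hasFiniteRange_pi fun l => hasFiniteRange_ofEndMatrix fun i j => ?_
  rw [Matrix.of_apply, ← mk_eq_mk_iff_hasFiniteRange, map_mul, map_mul]
  exact (hA i j l).symm

/-- The index of an invertible matrix over the Leavitt algebra is determined by its size. -/
lemma exists_index {r s : ℕ} {A : Matrix (Fin r) (Fin s) (Leavitt K n)}
    {B : Matrix (Fin s) (Fin r) (Leavitt K n)} (hAB : A * B = 1) (hBA : B * A = 1) :
    ∃ d : ℤ, r + d = n * d + s := by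
  have lift : ∀ a : Leavitt K n, ∃ T : End K (List (Fin n) → K),
      Ideal.Quotient.mk (finiteRangeIdeal K _) T = calkinHom K n a :=
    fun a => Ideal.Quotient.mk_surjective _
  choose L hL using lift
  have key : ∀ {a b : ℕ} {A : Matrix (Fin a) (Fin b) (Leavitt K n)}
      {B : Matrix (Fin b) (Fin a) (Leavitt K n)}, A * B = 1 →
      ofEndMatrix (A.map L) ∘ₗ ofEndMatrix (B.map L) ≈ LinearMap.id := by
    intro a b A B h
    rw [← ofEndMatrix_mul, ← ofEndMatrix_one]
    apply ofEndMatrix_equiv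
    have hmap : ∀ {a b : ℕ} (A : Matrix (Fin a) (Fin b) (Leavitt K n)),
        (A.map L).map (Ideal.Quotient.mk (finiteRangeIdeal K _)) = A.map (calkinHom K n) :=
      fun A => Matrix.ext fun i j => hL _
    rw [Matrix.map_mul, hmap, hmap, ← Matrix.map_mul, h, Matrix.map_one _ (map_zero _) (map_one _),
      Matrix.map_one _ (map_zero _) (map_one _)]
  set f := ofEndMatrix (A.map L)
  have hq : IsQuasiInverse (ofEndMatrix (B.map L)) f := ⟨key hBA, key hAB⟩
  have := hq.finiteDimensional_ker
  have := hq.finiteDimensional_coker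
  have hsplit : ∀ m, FiniteDimensional K (splitLast K n m).ker := fun m =>
    Module.Finite.equiv (kerSplitLastEquiv K n m).symm
  have hsplit' : ∀ m, FiniteDimensional K (_ ⧸ (splitLast K n m).range) := fun m => by
    rw [range_eq_top.mpr (splitLast_surjective K n m)]; infer_instance
  have : FiniteDimensional K (f.compLeft (Fin n)).ker :=
    Module.Finite.equiv (f.kerCompLeftEquiv (Fin n)).symm
  have : FiniteDimensional K (_ ⧸ (f.compLeft (Fin n)).range) :=
    Module.Finite.equiv (f.cokerCompLeftEquiv (Fin n)).symm
  have finite_comp {X Y Z : Type} [AddCommGroup X] [Module K X] [AddCommGroup Y] [Module K Y]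
      [AddCommGroup Z] [Module K Z] (g : Y →ₗ[K] Z) (f : X →ₗ[K] Y)
      [FiniteDimensional K f.ker] [FiniteDimensional K g.ker]
      [FiniteDimensional K (Y ⧸ f.range)] [FiniteDimensional K (Z ⧸ g.range)] :
      FiniteDimensional K (g ∘ₗ f).ker ∧ FiniteDimensional K (Z ⧸ (g ∘ₗ f).range) := by
    rw [ker_comp, range_comp]
    exact ⟨inferInstance, inferInstance⟩
  obtain ⟨_, _⟩ := finite_comp (splitLast K n r) f
  obtain ⟨_, _⟩ := finite_comp (f.compLeft (Fin n)) (splitLast K n s)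
  have h := index_eq_of_equiv (splitLast_comp_ofEndMatrix_equiv (A := A.map L) fun i j l => by
    rw [Matrix.map_apply, hL]
    exact commute_calkinHom_popBack K n _ _)
  rw [index_comp, index_comp, index_splitLast, index_splitLast, index_compLeft,
    Fintype.card_fin] at h
  exact ⟨_, h⟩

lemma modEq_of_linearEquiv {r s : ℕ} (hn : 1 ≤ n)
    (e : (Fin r → Leavitt K n) ≃ₗ[Leavitt K n] (Fin s → Leavitt K n)) :
    r ≡ s [MOD n - 1] := by
  have hAB : LinearMap.toMatrixRight' e.toLinearMap * LinearMap.toMatrixRight' e.symm.toLinearMap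
      = 1 := by
    apply Matrix.toLinearMapRight'.injective
    rw [Matrix.toLinearMapRight'_mul]
    simp
  have hBA : LinearMap.toMatrixRight' e.symm.toLinearMap * LinearMap.toMatrixRight' e.toLinearMap
      = 1 := by
    apply Matrix.toLinearMapRight'.injective
    rw [Matrix.toLinearMapRight'_mul]
    simp
  obtain ⟨d, hd⟩ := exists_index hAB hBA
  rw [Nat.modEq_iff_dvd]
  refine ⟨-d, ?_⟩
  push_cast [hn]
  linarith

end Invariant

section Iso

variable (K : Type) [Field K] (n : ℕ)

lemma lx_mul_ly (i j : Fin n) : lx K n i * ly K n j = if i = j then 1 else 0 := by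
  rw [lx, ly, ← map_mul, RingQuot.mkAlgHom_rel K (LeavittRel.xy i j)]
  split_ifs <;> simp

lemma sum_ly_mul_lx : ∑ j, ly K n j * lx K n j = 1 := by
  simp only [lx, ly, ← map_mul]
  rw [← map_sum, RingQuot.mkAlgHom_rel K LeavittRel.yx, map_one]

/-- The isomorphism `L_n ≃ L_n^n` of left modules given by right multiplication by the `y_j`. -/
noncomputable def selfEquivPi : Leavitt K n ≃ₗ[Leavitt K n] (Fin n → Leavitt K n) where
  toFun a j := a * ly K n j
  invFun b := ∑ j, b j * lx K n j
  map_add' a b := funext fun j => add_mul _ _ _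
  map_smul' c a := funext fun j => mul_assoc _ _ _
  left_inv a := by simp [mul_assoc, ← Finset.mul_sum, sum_ly_mul_lx]
  right_inv b := by
    ext j
    simp [Finset.sum_mul, mul_assoc, lx_mul_ly]

variable {K n}

lemma nonempty_linearEquiv_add (hn : 1 ≤ n) {r : ℕ} (hr : 1 ≤ r) :
    Nonempty ((Fin r → Leavitt K n) ≃ₗ[Leavitt K n] (Fin (r + (n - 1)) → Leavitt K n)) := by
  obtain ⟨r, rfl⟩ := Nat.exists_eq_add_of_le' hr
  let split (m l : ℕ) : (Fin (m + l) → Leavitt K n) ≃ₗ[Leavitt K n]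
      (Fin m → Leavitt K n) × (Fin l → Leavitt K n) :=
    (LinearEquiv.funCongrLeft _ _ finSumFinEquiv).trans
      (LinearEquiv.sumArrowLequivProdArrow _ _ _ _)
  have h : r + n = r + 1 + (n - 1) := by lia
  exact ⟨(split r 1).trans <| ((LinearEquiv.refl _ _).prodCongr
    ((LinearEquiv.funUnique _ _ _).trans (selfEquivPi K n))).trans <| (split r n).symm.trans
    (LinearEquiv.funCongrLeft _ _ (finCongr h.symm))⟩

lemma nonempty_linearEquiv_add_mul (hn : 1 ≤ n) {r : ℕ} (hr : 1 ≤ r) (t : ℕ) :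
    Nonempty ((Fin r → Leavitt K n) ≃ₗ[Leavitt K n] (Fin (r + (n - 1) * t) → Leavitt K n)) := by
  induction t with
  | zero => exact ⟨.refl _ _⟩
  | succ t ih =>
    obtain ⟨e⟩ := ih
    obtain ⟨e'⟩ := nonempty_linearEquiv_add (K := K) hn (hr.trans (r.le_add_right ((n - 1) * t)))
    rw [mul_add_one, ← add_assoc]
    exact ⟨e.trans e'⟩

lemma nonempty_linearEquiv_of_modEq (hn : 1 ≤ n) {r s : ℕ} (hr : 1 ≤ r) (hrs : r ≤ s)
    (h : r ≡ s [MOD n - 1]) :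
    Nonempty ((Fin r → Leavitt K n) ≃ₗ[Leavitt K n] (Fin s → Leavitt K n)) := by
  obtain ⟨t, ht⟩ := (Nat.modEq_iff_dvd' hrs).mp h
  obtain rfl : s = r + (n - 1) * t := by lia
  exact nonempty_linearEquiv_add_mul hn hr t

end Iso

end Leavitt

/-- `L_n` has module type `(1, n-1)`: the free left `L_n`-modules `L_n^r` and `L_n^s` are
isomorphic if and only if `r ≡ s (mod n-1)`. -/
theorem leavitt_free_module_iso_iff (K : Type) [Field K] (n : ℕ) (hn : 2 ≤ n)
    (r s : ℕ) (hr : 1 ≤ r) (hs : 1 ≤ s) :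
    Nonempty ((Fin r → Leavitt K n) ≃ₗ[Leavitt K n] (Fin s → Leavitt K n)) ↔
      r ≡ s [MOD n - 1] := by
  have hn' : 1 ≤ n := one_le_two.trans hn
  refine ⟨fun ⟨e⟩ => Leavitt.modEq_of_linearEquiv hn' e, fun h => ?_⟩
  rcases le_total r s with hrs | hsr
  · exact Leavitt.nonempty_linearEquiv_of_modEq hn' hr hrs h
  · exact (Leavitt.nonempty_linearEquiv_of_modEq hn' hs hsr h.symm).map LinearEquiv.symm
end
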